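/- arXiv:2301.02337 — 7 statements merged into one kernel-verified Lean document; each statement's English description precedes it below -/
import Mathlib

section
/- Let G be a finite group, σ_i a set of primes, H a σ_i-subgroup of G, and K a subgroup of G with H ≤ K ≤ G. If T is a σ_i-sylowizer of H in K, then there exists a σ_i-sylowizer S of H in G such that T = S ∩ K. -/
open Pointwise

/-- `n` is a `σ`-number: every prime divisor of `n` lies in `σ`. -/
def IsSigmaNumber (σ : Set ℕ) (n : ℕ) : Prop :=
  ∀ p : ℕ, p.Prime → p ∣ n → p ∈ σ

/-- `H` is a Hall `σ`-subgroup of `S` (both viewed as subgroups of an ambient group `G`):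
`H ≤ S`, `|H|` is a `σ`-number, and no prime in `σ` divides the index `|S : H|`. -/
def IsHallSigmaIn {G : Type*} [Group G] (σ : Set ℕ) (H S : Subgroup G) : Prop :=
  H ≤ S ∧ IsSigmaNumber σ (Nat.card H) ∧
    ∀ p : ℕ, p.Prime → p ∈ σ → ¬ p ∣ H.relIndex S

/-- `S` is a `σ`-sylowizer of `R` in `X` (all subgroups of an ambient group `G`):
`S ≤ X`, `R` is a Hall `σ`-subgroup of `S`, and `S` is maximal among subgroups of `X`
having `R` as a Hall `σ`-subgroup. -/
def IsSylowizerIn {G : Type*} [Group G] (σ : Set ℕ) (X R S : Subgroup G) : Prop :=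
  S ≤ X ∧ IsHallSigmaIn σ R S ∧
    ∀ S' : Subgroup G, S' ≤ X → IsHallSigmaIn σ R S' → S ≤ S' → S' = S

/-- The conjugate `xBx⁻¹` of a subgroup. -/
def conjSubgroup {G : Type*} [Group G] (x : G) (B : Subgroup G) : Subgroup G :=
  B.map (MulAut.conj x).toMonoidHom

/-- Two subgroups `A`, `B` of `G` are conditionally permutable in `G`:
there is `x ∈ G` with `A · Bˣ = Bˣ · A` (as set products), where `Bˣ = x⁻¹Bx`. -/
def CPermutable {G : Type*} [Group G] (A B : Subgroup G) : Prop :=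
  ∃ x : G, (A : Set G) * (conjSubgroup x⁻¹ B : Set G) = (conjSubgroup x⁻¹ B : Set G) * (A : Set G)

/-- `σ : I → Set ℕ` is a partition of the set of all primes into pairwise
disjoint nonempty sets of primes. -/
def IsPrimePartition {I : Type*} (σ : I → Set ℕ) : Prop :=
  (∀ i, (σ i).Nonempty) ∧ (∀ i, ∀ p ∈ σ i, p.Prime) ∧
    (∀ p : ℕ, p.Prime → ∃ i, p ∈ σ i) ∧
    (∀ i j, i ≠ j → Disjoint (σ i) (σ j))

/-- `σ i ∈ σ(G)`, i.e. `σ i` meets the set of prime divisors of `|G|`. -/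
def SigmaMem {I : Type*} (σ : I → Set ℕ) (G : Type*) [Group G] (i : I) : Prop :=
  ∃ p ∈ σ i, p ∣ Nat.card G

/-- `G` is `σ`-full: it has a Hall `σ i`-subgroup for every `σ i ∈ σ(G)`. -/
def SigmaFull {I : Type*} (σ : I → Set ℕ) (G : Type*) [Group G] : Prop :=
  ∀ i, SigmaMem σ G i → ∃ H : Subgroup G, IsHallSigmaIn (σ i) H ⊤

/-- `G` is a `σ`-full group of Sylow type: for each `σ i ∈ σ(G)` there is a
Hall `σ i`-subgroup `H` such that every `σ i`-subgroup of `G` lies in some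
`G`-conjugate of `H`. -/
def SigmaFullSylowType {I : Type*} (σ : I → Set ℕ) (G : Type*) [Group G] : Prop :=
  ∀ i, SigmaMem σ G i → ∃ H : Subgroup G, IsHallSigmaIn (σ i) H ⊤ ∧
    ∀ R : Subgroup G, IsSigmaNumber (σ i) (Nat.card R) → ∃ x : G, R ≤ conjSubgroup x H

/-- `O^σ(G)`: the intersection of all normal subgroups of `G` whose index is a `σ`-number. -/
def sigmaResidual (σ : Set ℕ) (G : Type*) [Group G] : Subgroup G :=
  sInf {N : Subgroup G | N.Normal ∧ IsSigmaNumber σ N.index}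

/-- `G` is supersoluble: there is a chain `⊥ = c 0 ≤ c 1 ≤ ⋯ ≤ c n = ⊤` of
subgroups, each normal in `G`, with each successive quotient cyclic (expressed by
saying the next term is generated by the previous one together with one element). -/
def IsSupersoluble (G : Type*) [Group G] : Prop :=
  ∃ (n : ℕ) (c : Fin (n + 1) → Subgroup G),
    c 0 = ⊥ ∧ c (Fin.last n) = ⊤ ∧ (∀ k, (c k).Normal) ∧
      (∀ k : Fin n, c k.castSucc ≤ c k.succ) ∧
      (∀ k : Fin n, ∃ g ∈ c k.succ, c k.castSucc ⊔ Subgroup.zpowers g = c k.succ)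

/-- If `T` is a `σᵢ`-sylowizer of `H` in `K` (where `H ≤ K ≤ G` and `H` is a
`σᵢ`-subgroup), then there is a `σᵢ`-sylowizer `S` of `H` in `G` with `T = S ∩ K`. -/
theorem stmt_0 {G : Type*} [Group G] [Finite G] (σi : Set ℕ) (H K T : Subgroup G)
    (hH : IsSigmaNumber σi (Nat.card H)) (hHK : H ≤ K)
    (hT : IsSylowizerIn σi K H T) :
    ∃ S : Subgroup G, IsSylowizerIn σi ⊤ H S ∧ T = S ⊓ K := by
  obtain ⟨hTK, hTH, hTmax⟩ := hT
  obtain ⟨S, hTS, hS⟩ := (Set.toFinite {S : Subgroup G | IsHallSigmaIn σi H S}).exists_le_maximal hTH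
  have hSH : IsHallSigmaIn σi H S := hS.prop
  refine ⟨S, ⟨le_top, hSH, fun S' _ h h' => le_antisymm (hS.le_of_ge h h') h'⟩, ?_⟩
  refine (hTmax (S ⊓ K) inf_le_right ⟨le_inf hSH.1 hHK, hH, ?_⟩ (le_inf hTS hTK)).symm
  intro p hp hpσ hdvd
  refine hSH.2.2 p hp hpσ (hdvd.trans ?_)
  rw [← Subgroup.relIndex_mul_relIndex H (S ⊓ K) S (le_inf hSH.1 hHK) inf_le_left]
  exact dvd_mul_right _ _
end

section
/- Let G be a finite group, σ_i a set of primes, R a σ_i-subgroup of G, and N a normal subgroup of G such that R is a Hall σ_i-subgroup of RN. If S is a σ_i-sylowizer of R in G, then N ≤ S and S/N is a σ_i-sylowizer of RN/N in G/N. -/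
open Pointwise

lemma card_mul_relIndex_aux {G : Type*} [Group G] {H K : Subgroup G} (h : H ≤ K) :
    Nat.card H * H.relIndex K = Nat.card K := by
  rw [← Subgroup.relIndex_bot_left, ← Subgroup.relIndex_bot_left]
  exact Subgroup.relIndex_mul_relIndex ⊥ H K bot_le h

lemma hall_aux {G : Type*} [Group G] [Finite G] (S N : Subgroup G) [N.Normal] :
    S.relIndex (S ⊔ N) = S.relIndex N := by
  have h1 : Nat.card N * N.relIndex (S ⊔ N) = Nat.card (S ⊔ N : Subgroup G) :=
    card_mul_relIndex_aux le_sup_right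
  have h2 : Nat.card S * S.relIndex (S ⊔ N) = Nat.card (S ⊔ N : Subgroup G) :=
    card_mul_relIndex_aux le_sup_left
  have h3 : Nat.card (N ⊓ S : Subgroup G) * (N ⊓ S).relIndex S = Nat.card S :=
    card_mul_relIndex_aux inf_le_right
  have h4 : Nat.card (N ⊓ S : Subgroup G) * (N ⊓ S).relIndex N = Nat.card N :=
    card_mul_relIndex_aux inf_le_left
  rw [Subgroup.inf_relIndex_right] at h3
  rw [Subgroup.inf_relIndex_left] at h4
  have h5 : N.relIndex (S ⊔ N) = N.relIndex S := Subgroup.relIndex_sup_right _ _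
  have h6 : 0 < Nat.card S := Nat.card_pos
  apply Nat.eq_of_mul_eq_mul_left h6
  rw [h2, ← h1, ← h3, ← h4, h5]
  ring

/-- If `R` is a Hall `σᵢ`-subgroup of `RN` and `S` is a `σᵢ`-sylowizer of `R`
in `G`, then `N ≤ S` and `S/N` is a `σᵢ`-sylowizer of `RN/N` in `G/N`. -/
theorem stmt_1 {G : Type*} [Group G] [Finite G] (σi : Set ℕ) (R N S : Subgroup G) [N.Normal]
    (hR : IsSigmaNumber σi (Nat.card R))
    (hHall : IsHallSigmaIn σi R (R ⊔ N))
    (hS : IsSylowizerIn σi ⊤ R S) :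
    N ≤ S ∧ IsSylowizerIn σi ⊤ ((R ⊔ N).map (QuotientGroup.mk' N))
      (S.map (QuotientGroup.mk' N)) := by
  have hN : S ⊔ N = S := by
    obtain ⟨-, ⟨hRS, -, hidx⟩, hmax⟩ := hS
    refine hmax _ le_top ⟨hRS.trans le_sup_left, hR, ?_⟩ le_sup_left
    intro p hp hpσ hdvd
    rw [← Subgroup.relIndex_mul_relIndex R S (S ⊔ N) hRS le_sup_left, hall_aux] at hdvd
    rcases hp.dvd_mul.1 hdvd with h | h
    · exact hidx p hp hpσ h
    · refine hHall.2.2 p hp hpσ ?_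
      rw [hall_aux]
      exact h.trans (Subgroup.relIndex_dvd_of_le_left N hRS)
  have hNS : N ≤ S := by rw [← hN]; exact le_sup_right
  have hc : ((R ⊔ N).map (QuotientGroup.mk' N)).comap (QuotientGroup.mk' N) = R ⊔ N :=
    Subgroup.comap_map_eq_self (by simp)
  have hcS : (S.map (QuotientGroup.mk' N)).comap (QuotientGroup.mk' N) = S :=
    Subgroup.comap_map_eq_self (by simpa using hNS)
  have hRNS : R ⊔ N ≤ S := sup_le hS.2.1.1 hNS
  refine ⟨hNS, le_top, ⟨Subgroup.map_mono hRNS, ?_, ?_⟩, ?_⟩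
  · have h : (R ⊔ N).map (QuotientGroup.mk' N) = R.map (QuotientGroup.mk' N) := by
      rw [Subgroup.map_sup, QuotientGroup.map_mk'_self, sup_bot_eq]
    rw [h]
    intro p hp hd
    exact hR p hp (hd.trans (Subgroup.card_map_dvd _ _))
  · intro p hp hpσ hd
    rw [← Subgroup.relIndex_comap, hc] at hd
    refine hS.2.1.2.2 p hp hpσ (hd.trans ?_)
    exact Subgroup.relIndex_dvd_of_le_left S le_sup_left
  · intro S' _ hS' hle
    have hmc : (S'.comap (QuotientGroup.mk' N)).map (QuotientGroup.mk' N) = S' :=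
      Subgroup.map_comap_eq_self_of_surjective (QuotientGroup.mk'_surjective N) S'
    have hle1 : S ≤ S'.comap (QuotientGroup.mk' N) := Subgroup.map_le_iff_le_comap.1 hle
    have key := hS.2.2 (S'.comap (QuotientGroup.mk' N)) le_top
      ⟨hS.2.1.1.trans hle1, hR, ?_⟩ hle1
    · rw [← hmc, key]
    · intro p hp hpσ hd
      rw [← Subgroup.relIndex_mul_relIndex R (R ⊔ N) _ le_sup_left (hRNS.trans hle1)] at hd
      rcases hp.dvd_mul.1 hd with h | h
      · exact hHall.2.2 p hp hpσ h
      · refine hS'.2.2 p hp hpσ ?_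
        rwa [← hc, Subgroup.relIndex_comap, hmc] at h
end

section
/- Let G be a finite group, σ_i a set of primes, R a σ_i-subgroup of G, and N a normal subgroup of G such that R is a Hall σ_i-subgroup of RN. If S is a subgroup of G with R ≤ S and N ≤ S, and S/N is a σ_i-sylowizer of RN/N in G/N, then S is a σ_i-sylowizer of R in G. -/
open Pointwise

/-- If `R` is a Hall `σᵢ`-subgroup of `RN`, `R ≤ S`, `N ≤ S`, and `S/N` is a
`σᵢ`-sylowizer of `RN/N` in `G/N`, then `S` is a `σᵢ`-sylowizer of `R` in `G`. -/
theorem stmt_2 {G : Type*} [Group G] [Finite G] (σi : Set ℕ) (R N S : Subgroup G) [N.Normal]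
    (hR : IsSigmaNumber σi (Nat.card R))
    (hHall : IsHallSigmaIn σi R (R ⊔ N))
    (hRS : R ≤ S) (hNS : N ≤ S)
    (hSq : IsSylowizerIn σi ⊤ ((R ⊔ N).map (QuotientGroup.mk' N))
      (S.map (QuotientGroup.mk' N))) :
    IsSylowizerIn σi ⊤ R S := by
  have hle : R ⊔ N ≤ S := sup_le hRS hNS
  have key : ∀ T : Subgroup G, N ≤ T →
      ((R ⊔ N).map (QuotientGroup.mk' N)).relIndex (T.map (QuotientGroup.mk' N))
        = (R ⊔ N).relIndex T := by
    intro T hT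
    rw [Subgroup.relIndex_map_map, QuotientGroup.ker_mk', sup_assoc, sup_idem,
      sup_eq_left.mpr hT]
  obtain ⟨-, ⟨-, hcard, hidx⟩, hmax⟩ := hSq
  refine ⟨le_top, ⟨hRS, hR, ?_⟩, ?_⟩
  · intro p hp hpσ hdvd
    rw [← Subgroup.relIndex_mul_relIndex R (R ⊔ N) S le_sup_left hle] at hdvd
    rcases hp.dvd_mul.mp hdvd with h | h
    · exact hHall.2.2 p hp hpσ h
    · exact hidx p hp hpσ (by rw [key S hNS]; exact h)
  · intro T _ hT hST
    have hNT := hNS.trans hST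
    have h := hmax (T.map (QuotientGroup.mk' N)) le_top
      ⟨Subgroup.map_mono (hle.trans hST), hcard, ?_⟩ (Subgroup.map_mono hST)
    · have h2 := congrArg (Subgroup.comap (QuotientGroup.mk' N)) h
      rwa [Subgroup.comap_map_eq, Subgroup.comap_map_eq, QuotientGroup.ker_mk',
        sup_eq_left.mpr hNT, sup_eq_left.mpr hNS] at h2
    · intro p hp hpσ hdvd
      rw [key T hNT] at hdvd
      refine hT.2.2 p hp hpσ ?_
      rw [← Subgroup.relIndex_mul_relIndex R (R ⊔ N) T le_sup_left (hle.trans hST)]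
      exact hdvd.mul_left _
end

section
/- Let G be a finite group, σ_i and σ_j disjoint sets of primes, R a σ_i-subgroup of G, and S a σ_i-sylowizer of R in G. If Q is a Hall σ_j-subgroup of G such that S permutes with Q (i.e., the set product SQ equals QS, so that SQ is a subgroup of G), then Q ≤ S. -/
open Pointwise

/-- If `S` is a `σᵢ`-sylowizer of a `σᵢ`-subgroup `R` in `G`, `σᵢ` and `σⱼ` are
disjoint, and `Q` is a Hall `σⱼ`-subgroup of `G` permuting with `S`, then `Q ≤ S`. -/
theorem stmt_3 {G : Type*} [Group G] [Finite G] (σi σj : Set ℕ) (hdisj : Disjoint σi σj)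
    (R S Q : Subgroup G)
    (hR : IsSigmaNumber σi (Nat.card R))
    (hS : IsSylowizerIn σi ⊤ R S)
    (hQ : IsHallSigmaIn σj Q ⊤)
    (hperm : (S : Set G) * (Q : Set G) = (Q : Set G) * (S : Set G)) :
    Q ≤ S := by
  obtain ⟨-, ⟨hRS, hRc, hRi⟩, hmax⟩ := hS
  let T : Subgroup G :=
    { carrier := (Q : Set G) * (S : Set G)
      one_mem' := ⟨1, Q.one_mem, 1, S.one_mem, by simp⟩
      mul_mem' := by
        intro a b ha hb
        have h : a * b ∈ ((Q : Set G) * (S : Set G)) * ((Q : Set G) * (S : Set G)) :=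
          Set.mul_mem_mul ha hb
        have e : ((Q : Set G) * (S : Set G)) * ((Q : Set G) * (S : Set G))
            = (Q : Set G) * (S : Set G) := by
          rw [mul_assoc, ← mul_assoc (S : Set G), hperm, mul_assoc (Q : Set G), coe_mul_coe,
            ← mul_assoc, coe_mul_coe]
        rwa [e] at h
      inv_mem' := by
        rintro _ ⟨q, hq, s, hs, rfl⟩
        rw [← hperm]
        exact ⟨s⁻¹, S.inv_mem hs, q⁻¹, Q.inv_mem hq, by simp⟩ }
  have hST : S ≤ T := fun s hs => ⟨1, Q.one_mem, s, hs, by simp⟩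
  have hQT : Q ≤ T := fun q hq => ⟨q, hq, 1, S.one_mem, by simp⟩
  have hidx : S.relIndex T ∣ Nat.card Q := by
    have h : S.relIndex Q = S.relIndex T := by
      apply Nat.card_congr
      apply Equiv.ofBijective (Subgroup.quotientSubgroupOfEmbeddingOfLE S hQT)
      refine ⟨(Subgroup.quotientSubgroupOfEmbeddingOfLE S hQT).injective, fun x => ?_⟩
      induction x using QuotientGroup.induction_on with
      | H z =>
        obtain ⟨_, q, hq, s, hs, rfl⟩ := z
        refine ⟨QuotientGroup.mk ⟨q, hq⟩, ?_⟩
        rw [Subgroup.quotientSubgroupOfEmbeddingOfLE_apply_mk]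
        refine QuotientGroup.eq.2 ?_
        simpa [Subgroup.mem_subgroupOf] using hs
    rw [← h]
    exact Subgroup.relIndex_dvd_card S Q
  have hT : T = S := by
    refine hmax T le_top ⟨hRS.trans hST, hRc, fun p hp hpi hd => ?_⟩ hST
    rw [← Subgroup.relIndex_mul_relIndex R S T hRS hST] at hd
    rcases hp.dvd_mul.1 hd with h | h
    · exact hRi p hp hpi h
    · exact Set.disjoint_left.1 hdisj hpi (hQ.2.1 p hp (h.trans hidx))
  exact hT ▸ hQT
end

section
/- Let σ = {σ_i | i ∈ I} be a partition of the set of all primes, G a finite σ-full group, σ_i ∈ σ(G), R a σ_i-subgroup of G, and S a σ_i-sylowizer of R in G. Suppose that for every σ_j ∈ σ(G) with j ≠ i, S permutes with every G-conjugate of every Hall σ_j-subgroup of G (i.e., for every such Hall σ_j-subgroup Q and every x ∈ G, the set product S·Q^x equals Q^x·S). Then O^{σ_i}(G) ≤ S; in particular, S = R·O^{σ_i}(G) and S is the unique σ_i-sylowizer of R in G. -/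
open Pointwise

/-- The subgroup with carrier `Q * S` when `S` and `Q` permute. -/
def permProd {G : Type*} [Group G] (Q S : Subgroup G)
    (h : (S : Set G) * (Q : Set G) = (Q : Set G) * (S : Set G)) : Subgroup G where
  carrier := (Q : Set G) * (S : Set G)
  one_mem' := ⟨1, Q.one_mem, 1, S.one_mem, by simp⟩
  mul_mem' := by
    rintro _ _ ⟨a, ha, b, hb, rfl⟩ ⟨c, hc, d, hd, rfl⟩
    have hbc : b * c ∈ (Q : Set G) * (S : Set G) := by
      rw [← h]; exact ⟨b, hb, c, hc, rfl⟩
    obtain ⟨e, he, f, hf, hef⟩ := hbc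
    refine ⟨a * e, Q.mul_mem ha he, f * d, S.mul_mem hf hd, ?_⟩
    have hef' : e * f = b * c := hef
    change a * e * (f * d) = a * b * (c * d)
    calc a * e * (f * d) = a * (e * f) * d := by group
      _ = a * b * (c * d) := by rw [hef']; group
  inv_mem' := by
    rintro _ ⟨a, ha, b, hb, rfl⟩
    change (a * b)⁻¹ ∈ (Q : Set G) * (S : Set G)
    rw [← h, mul_inv_rev]
    exact ⟨b⁻¹, S.inv_mem hb, a⁻¹, Q.inv_mem ha, rfl⟩

theorem relIndex_permProd_dvd {G : Type*} [Group G] [Finite G] (Q S : Subgroup G)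
    (h : (S : Set G) * (Q : Set G) = (Q : Set G) * (S : Set G)) :
    S.relIndex (permProd Q S h) ∣ Nat.card Q := by
  have hQ : Q ≤ permProd Q S h := fun q hq => ⟨q, hq, 1, S.one_mem, by simp⟩
  have key : S.relIndex Q = S.relIndex (permProd Q S h) := by
    refine Nat.card_congr (Equiv.ofBijective (Subgroup.quotientSubgroupOfEmbeddingOfLE S hQ)
      ⟨(Subgroup.quotientSubgroupOfEmbeddingOfLE S hQ).injective, ?_⟩)
    intro y
    induction y using QuotientGroup.induction_on with
    | H y =>
      obtain ⟨y, q, hq, s, hs, rfl⟩ := y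
      refine ⟨QuotientGroup.mk ⟨q, hq⟩, ?_⟩
      rw [Subgroup.quotientSubgroupOfEmbeddingOfLE_apply_mk, QuotientGroup.eq,
        Subgroup.mem_subgroupOf]
      simpa using hs
  rw [← key]
  exact Subgroup.relIndex_dvd_card S Q

theorem hall_le_sup {G : Type*} [Group G] [Finite G] {π : Set ℕ} (N R T : Subgroup G)
    (hN : N.Normal) (hNi : IsSigmaNumber π N.index) (hT : IsHallSigmaIn π R T) :
    T ≤ R ⊔ N := by
  rw [← Subgroup.relIndex_eq_one]
  by_contra hne
  obtain ⟨p, hp, hpd⟩ := Nat.exists_prime_and_dvd hne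
  have h1 : p ∣ R.relIndex T := hpd.trans (Subgroup.relIndex_dvd_of_le_left T le_sup_left)
  have h2 : p ∣ N.index := (hpd.trans (Subgroup.relIndex_dvd_of_le_left T le_sup_right)).trans
    (Subgroup.relIndex_dvd_index_of_normal N T)
  exact hT.2.2 p hp (hNi p hp h2) h1

/-- In a `σ`-full group `G`, if a `σᵢ`-sylowizer `S` of a `σᵢ`-subgroup `R`
permutes with every `G`-conjugate of every Hall `σⱼ`-subgroup of `G` for all `σⱼ ∈ σ(G)`
with `j ≠ i`, then `O^{σᵢ}(G) ≤ S`; in particular `S = R·O^{σᵢ}(G)` and `S` is the unique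
`σᵢ`-sylowizer of `R` in `G`. -/
theorem stmt_4 {G : Type*} [Group G] [Finite G] {I : Type*} (σ : I → Set ℕ)
    (hσ : IsPrimePartition σ) (hfull : SigmaFull σ G) (i : I) (hi : SigmaMem σ G i)
    (R S : Subgroup G)
    (hR : IsSigmaNumber (σ i) (Nat.card R))
    (hS : IsSylowizerIn (σ i) ⊤ R S)
    (hperm : ∀ j, j ≠ i → SigmaMem σ G j → ∀ Q : Subgroup G, IsHallSigmaIn (σ j) Q ⊤ →
      ∀ x : G, (S : Set G) * (conjSubgroup x Q : Set G)
        = (conjSubgroup x Q : Set G) * (S : Set G)) :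
    sigmaResidual (σ i) G ≤ S ∧ S = R ⊔ sigmaResidual (σ i) G ∧
      ∀ S' : Subgroup G, IsSylowizerIn (σ i) ⊤ R S' → S' = S := by
  obtain ⟨-, hprime, hcov, hdisj⟩ := hσ
  obtain ⟨-, hHall, hmax⟩ := hS
  have hne : ∀ p j, j ≠ i → p ∈ σ j → p ∉ σ i := fun p j hj h1 h2 =>
    Set.disjoint_left.mp (hdisj j i hj) h1 h2
  -- every conjugate of every Hall subgroup lies in `S`
  have hle : ∀ j, j ≠ i → SigmaMem σ G j → ∀ Q : Subgroup G, IsHallSigmaIn (σ j) Q ⊤ →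
      ∀ x : G, conjSubgroup x Q ≤ S := by
    intro j hj hm Q hQ x
    have hp := hperm j hj hm Q hQ x
    have hcard : Nat.card (conjSubgroup x Q) = Nat.card Q :=
      (Nat.card_congr (Q.equivMapOfInjective _ (MulAut.conj x).injective).toEquiv).symm
    have hST : S ≤ permProd (conjSubgroup x Q) S hp :=
      fun s hs => ⟨1, Subgroup.one_mem _, s, hs, by simp⟩
    have hQT : conjSubgroup x Q ≤ permProd (conjSubgroup x Q) S hp :=
      fun q hq => ⟨q, hq, 1, S.one_mem, by simp⟩
    have heq := hmax (permProd (conjSubgroup x Q) S hp) le_top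
      ⟨hHall.1.trans hST, hR, ?_⟩ hST
    · rw [heq] at hQT
      exact hQT
    · intro p hpp hpi hpd
      rw [← Subgroup.relIndex_mul_relIndex _ _ _ hHall.1 hST] at hpd
      rcases (Nat.Prime.dvd_mul hpp).mp hpd with h1 | h1
      · exact hHall.2.2 p hpp hpi h1
      · have h2 := h1.trans (relIndex_permProd_dvd _ _ hp)
        rw [hcard] at h2
        exact hne p j hj (hQ.2.1 p hpp h2) hpi
  let A : Set G := {g | ∃ j, j ≠ i ∧ SigmaMem σ G j ∧ ∃ Q : Subgroup G,
    IsHallSigmaIn (σ j) Q ⊤ ∧ g ∈ Q}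
  let N : Subgroup G := Subgroup.normalClosure A
  have hNn : N.Normal := Subgroup.normalClosure_normal
  have hNS : N ≤ S := by
    change Subgroup.closure (Group.conjugatesOfSet A) ≤ S
    rw [Subgroup.closure_le]
    intro g hg
    obtain ⟨a, ⟨j, hj, hm, Q, hQ, ha⟩, hc⟩ := Group.mem_conjugatesOfSet_iff.mp hg
    obtain ⟨x, rfl⟩ := isConj_iff.mp hc
    exact hle j hj hm Q hQ x ⟨a, ha, rfl⟩
  have hNi : IsSigmaNumber (σ i) N.index := by
    intro p hp hpd
    obtain ⟨j, hj⟩ := hcov p hp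
    by_cases hji : j = i
    · rwa [← hji]
    · exfalso
      have hm : SigmaMem σ G j := ⟨p, hj, hpd.trans (Subgroup.index_dvd_card N)⟩
      obtain ⟨Q, hQ⟩ := hfull j hm
      have hQN : Q ≤ N := fun q hq =>
        Subgroup.subset_normalClosure ⟨j, hji, hm, Q, hQ, hq⟩
      refine hQ.2.2 p hp hj ?_
      rw [Subgroup.relIndex_top_right]
      exact hpd.trans (Subgroup.index_dvd_of_le hQN)
  have hO : sigmaResidual (σ i) G = N := by
    apply le_antisymm
    · exact sInf_le ⟨hNn, hNi⟩
    · refine le_sInf ?_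
      rintro M ⟨hM, hMi⟩
      refine Subgroup.normalClosure_le_normal ?_
      rintro g ⟨j, hj, hm, Q, hQ, hg⟩
      have hQM : Q ≤ M := by
        rw [← Subgroup.relIndex_eq_one]
        by_contra hne1
        obtain ⟨p, hp, hpd⟩ := Nat.exists_prime_and_dvd hne1
        exact hne p j hj (hQ.2.1 p hp (hpd.trans (Subgroup.relIndex_dvd_card M Q)))
          (hMi p hp (hpd.trans (Subgroup.relIndex_dvd_index_of_normal M Q)))
      exact hQM hg
  rw [hO]
  have hSe : S = R ⊔ N := le_antisymm (hall_le_sup N R S hNn hNi hHall) (sup_le hHall.1 hNS)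
  refine ⟨hNS, hSe, ?_⟩
  rintro S' ⟨-, hHall', hmax'⟩
  have h1 : S' ≤ S := by
    rw [hSe]
    exact hall_le_sup N R S' hNn hNi hHall'
  exact (hmax' S le_top hHall h1).symm
end

section
/- Let σ = {σ_i | i ∈ I} be a partition of the set of all primes, G a finite σ-full group of Sylow type, σ_i ∈ σ(G), R a σ_i-subgroup of G, and S a σ_i-sylowizer of R in G. If S is c-permutable in G with every Hall σ_j-subgroup of G for every σ_j ∈ σ(G), then the index |G : S| is a σ_i-number. -/
open Pointwise

/-- If `T = Q S` as sets, then `|T : S| = |Q : S ∩ Q|`. -/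
theorem relIndex_eq_of_product {G : Type*} [Group G] {S Q T : Subgroup G} (hQT : Q ≤ T)
    (hST : S ≤ T) (h : ∀ t ∈ T, ∃ q ∈ Q, ∃ s ∈ S, q * s = t) :
    S.relIndex T = S.relIndex Q := by
  symm
  refine Nat.card_congr (Equiv.ofBijective (Subgroup.quotientSubgroupOfEmbeddingOfLE S hQT)
    ⟨(Subgroup.quotientSubgroupOfEmbeddingOfLE S hQT).injective, ?_⟩)
  intro y
  induction y using QuotientGroup.induction_on with
  | H t =>
    obtain ⟨q, hq, s, hs, hqs⟩ := h t t.2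
    refine ⟨QuotientGroup.mk ⟨q, hq⟩, ?_⟩
    rw [Subgroup.quotientSubgroupOfEmbeddingOfLE_apply_mk, QuotientGroup.eq]
    have : q⁻¹ * (t : G) = s := by rw [← hqs]; group
    simpa [Subgroup.mem_subgroupOf, this] using hs

/-- The subgroup formed by the product of two permuting subgroups. -/
theorem exists_product_subgroup {G : Type*} [Group G] {S Q : Subgroup G}
    (h : (S : Set G) * (Q : Set G) = (Q : Set G) * (S : Set G)) :
    ∃ T : Subgroup G, S ≤ T ∧ Q ≤ T ∧ ∀ t ∈ T, ∃ q ∈ Q, ∃ s ∈ S, q * s = t := by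
  refine ⟨{ carrier := (Q : Set G) * (S : Set G), mul_mem' := ?_, one_mem' := ?_, inv_mem' := ?_ },
    ?_, ?_, ?_⟩
  · intro a b ha hb
    have := Set.mul_mem_mul ha hb
    rwa [mul_assoc, ← mul_assoc (S : Set G), h, mul_assoc (Q : Set G) (S : Set G) (S : Set G),
      coe_mul_coe, ← mul_assoc, coe_mul_coe] at this
  · exact ⟨1, Q.one_mem, 1, S.one_mem, mul_one 1⟩
  · rintro _ ⟨q, hq, s, hs, rfl⟩
    change (q * s)⁻¹ ∈ (Q : Set G) * (S : Set G)
    rw [← h, mul_inv_rev]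
    exact Set.mul_mem_mul (S.inv_mem hs) (Q.inv_mem hq)
  · intro s hs
    exact ⟨1, Q.one_mem, s, hs, one_mul s⟩
  · intro q hq
    exact ⟨q, hq, 1, S.one_mem, mul_one q⟩
  · rintro t ⟨q, hq, s, hs, hqs⟩
    exact ⟨q, hq, s, hs, hqs⟩

/-- In a `σ`-full group of Sylow type, if a `σᵢ`-sylowizer `S` of a
`σᵢ`-subgroup `R` is `c`-permutable with every Hall `σⱼ`-subgroup of `G` for every
`σⱼ ∈ σ(G)`, then `|G : S|` is a `σᵢ`-number. -/
theorem stmt_5 {G : Type*} [Group G] [Finite G] {I : Type*} (σ : I → Set ℕ)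
    (hσ : IsPrimePartition σ) (hfull : SigmaFullSylowType σ G) (i : I) (hi : SigmaMem σ G i)
    (R S : Subgroup G)
    (hR : IsSigmaNumber (σ i) (Nat.card R))
    (hS : IsSylowizerIn (σ i) ⊤ R S)
    (hperm : ∀ j, SigmaMem σ G j → ∀ Q : Subgroup G, IsHallSigmaIn (σ j) Q ⊤ →
      CPermutable S Q) :
    IsSigmaNumber (σ i) S.index := by
  intro p hp hpS
  obtain ⟨j, hj⟩ := hσ.2.2.1 p hp
  by_cases hij : j = i
  · exact hij ▸ hj
  exfalso
  have hmem : SigmaMem σ G j := ⟨p, hj, hpS.trans S.index_dvd_card⟩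
  obtain ⟨Q, hQ, -⟩ := hfull j hmem
  obtain ⟨x, hx⟩ := hperm j hmem Q hQ
  have hinj : Function.Injective (MulAut.conj x⁻¹).toMonoidHom := (MulAut.conj x⁻¹).injective
  have hcard : Nat.card (conjSubgroup x⁻¹ Q) = Nat.card Q :=
    Subgroup.card_map_of_injective hinj
  have hindex : (conjSubgroup x⁻¹ Q).index = Q.index := by
    have h1 := (conjSubgroup x⁻¹ Q).card_mul_index
    rw [hcard, ← Q.card_mul_index] at h1
    exact Nat.eq_of_mul_eq_mul_left Nat.card_pos h1
  obtain ⟨T, hST, hQT, hT⟩ := exists_product_subgroup hx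
  have hrel := relIndex_eq_of_product hQT hST hT
  obtain ⟨-, ⟨hRS, -, hRp⟩, hmax⟩ := hS
  have hTS : T = S := by
    refine hmax T le_top ⟨hRS.trans hST, hR, ?_⟩ hST
    intro r hr hri hdvd
    rw [← Subgroup.relIndex_mul_relIndex R S T hRS hST] at hdvd
    rcases hr.dvd_mul.1 hdvd with hd | hd
    · exact hRp r hr hri hd
    · rw [hrel] at hd
      have hrQ : r ∣ Nat.card Q := hcard ▸ hd.trans (Subgroup.relIndex_dvd_card _ _)
      exact Set.disjoint_left.1 (hσ.2.2.2 j i hij) (hQ.2.1 r hr hrQ) hri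
  rw [hTS] at hQT
  apply hQ.2.2 p hp hj
  rw [Subgroup.relIndex_top_right, ← hindex]
  exact hpS.trans (Subgroup.index_dvd_of_le hQT)
end

section
/- Let σ = {σ_i | i ∈ I} be a partition of the set of all primes and G a finite σ-full group of Sylow type with a complete Hall σ-set 𝓗 = {H_1, …, H_t} such that each H_i is a nilpotent σ_i-subgroup. Suppose that for every i ∈ {1, …, t}, whenever H_i is non-cyclic, every maximal subgroup of H_i has a σ_i-sylowizer in G that is c-permutable in G with every member of 𝓗. Then G is supersoluble. -/
open Pointwise

theorem aux_eq_top_of_sylow {A : Type*} [Group A] [Finite A] (D : Subgroup A)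
    (h : ∀ q : ℕ, q.Prime → ∀ P : Sylow q A, (P : Subgroup A) ≤ D) : D = ⊤ := by
  by_contra hD
  have h1 : D.index ≠ 1 := fun h => hD (Subgroup.index_eq_one.mp h)
  obtain ⟨q, hq, hqd⟩ := Nat.exists_prime_and_dvd h1
  have := Fact.mk hq
  obtain ⟨P⟩ : Nonempty (Sylow q A) := inferInstance
  exact P.not_dvd_index (hqd.trans (Subgroup.index_dvd_of_le (h q hq P)))

/-- proper subgroups of a `p`-group lie in a subgroup of index `p` -/
theorem aux_exists_index {P : Type*} [Group P] [Finite P] {p : ℕ} (hp : p.Prime)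
    (hP : IsPGroup p P) (T : Subgroup P) (hT : T ≠ ⊤) :
    ∃ M : Subgroup P, T ≤ M ∧ M.index = p := by
  have := Fact.mk hp
  obtain ⟨n, hn⟩ := IsPGroup.iff_card.mp hP
  obtain ⟨m, hm⟩ := IsPGroup.iff_card.mp (hP.to_subgroup T)
  have hlt : m < n := by
    have h1 : Nat.card T < Nat.card P := by
      refine lt_of_le_of_ne (Subgroup.card_le_card_group T) fun h => hT ?_
      exact (Subgroup.card_eq_iff_eq_top T).mp h
    rw [hn, hm] at h1
    exact (Nat.pow_lt_pow_iff_right hp.one_lt).mp h1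
  obtain ⟨M, hM, hTM⟩ := Sylow.exists_subgroup_card_pow_prime_le p (n := m) (m := n - 1)
    (by rw [hn]; exact pow_dvd_pow _ (by omega)) T hm (by omega)
  refine ⟨M, hTM, ?_⟩
  have := M.card_mul_index
  rw [hM, hn, show n = (n - 1) + 1 by omega, pow_succ] at this
  simpa [hp.ne_zero] using this

theorem aux_index_normal {P : Type*} [Group P] [Finite P] {p : ℕ} (hp : p.Prime)
    (hP : IsPGroup p P) (M : Subgroup P) (hM : M.index = p) : M.Normal := by
  have := Fact.mk hp
  obtain ⟨n, hn⟩ := IsPGroup.iff_card.mp hP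
  apply Subgroup.normal_of_index_eq_minFac_card
  rw [hM, hn]
  have : n ≠ 0 := by
    rintro rfl
    have := M.index_dvd_card
    rw [hn, hM] at this
    exact hp.one_lt.ne' (by simpa using this)
  rw [Nat.Prime.pow_minFac hp this]

theorem aux_comm_eq {R : Type*} [Group R] [Group.IsNilpotent R] (Y : Subgroup R)
    (h : Y ≤ ⁅Y, (⊤ : Subgroup R)⁆) : Y = ⊥ := by
  obtain ⟨n, hn⟩ := Subgroup.nilpotent_iff_lowerCentralSeries.mp (inferInstance : Group.IsNilpotent R)
  rw [eq_bot_iff, ← hn]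
  clear hn
  induction n with
  | zero => simp
  | succ k ih => exact h.trans (Subgroup.commutator_mono ih le_rfl)

theorem aux_step {P : Type*} [Group P] [Finite P] {p : ℕ} (hp : p.Prime)
    (hP : IsPGroup p P) (Y : Subgroup P) [Y.Normal] (hY : Y ≠ ⊥) :
    ∃ X : Subgroup P, X.Normal ∧ X ≤ Y ∧ X.relIndex Y = p ∧
      ∀ y ∈ Y, ∀ g, y * g * y⁻¹ * g⁻¹ ∈ X := by
  have := Fact.mk hp
  have : Group.IsNilpotent P := hP.isNilpotent
  have hC : ⁅Y, (⊤ : Subgroup P)⁆ ≤ Y := Subgroup.commutator_le_left _ _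
  obtain ⟨M, hM, hMi⟩ := aux_exists_index hp (hP.to_subgroup Y) (⁅Y, (⊤ : Subgroup P)⁆.subgroupOf Y)
    (fun h => hY (aux_comm_eq Y (Subgroup.subgroupOf_eq_top.mp h)))
  have hcomm : ∀ y ∈ Y, ∀ g, y * g * y⁻¹ * g⁻¹ ∈ M.map Y.subtype := by
    intro y hy g
    have h1 : y * g * y⁻¹ * g⁻¹ ∈ ⁅Y, (⊤ : Subgroup P)⁆ :=
      Subgroup.commutator_mem_commutator hy (Subgroup.mem_top g)
    exact ⟨⟨_, hC h1⟩, hM (Subgroup.mem_subgroupOf.mpr h1), rfl⟩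
  have hle : M.map Y.subtype ≤ Y := Subgroup.map_subtype_le M
  refine ⟨M.map Y.subtype, ⟨fun x hx g => ?_⟩, hle, ?_, hcomm⟩
  · have h1 := hcomm x (hle hx) g
    have h2 := mul_mem (inv_mem h1) hx
    simpa [mul_assoc] using h2
  · rw [Subgroup.relIndex, Subgroup.subgroupOf, Subgroup.comap_map_eq_self_of_injective
      Y.subtype_injective, hMi]
open scoped IsMulCommutative in
/-- transfer argument in the pullback of `G → G ⧸ N ← B` -/
theorem aux_tate_step {G : Type*} [Group G] [Finite G] (P N : Subgroup G) [N.Normal]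
    {B : Type*} [Group B] [Finite B] (π : P →* B) (θ : B →* G ⧸ N)
    (hθ : ∀ y : P, θ (π y) = ((y : G) : G ⧸ N)) (hsurj : Function.Surjective θ)
    (hc : ∀ z ∈ θ.ker, ∀ b, z * b = b * z) :
    ∃ (W : N →* θ.ker) (δ : P →* θ.ker),
      (∀ (h : G) (n n' : N), (n' : G) = h * n * h⁻¹ → W n' = W n) ∧
      ∀ (y : P) (n : N) (z : θ.ker), (y : G) = n → π y = z → δ y = W n * z ^ P.index := by
  have hcm : IsMulCommutative θ.ker :=
    ⟨⟨fun a b => Subtype.ext (hc a a.2 b)⟩⟩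
  let E : Subgroup (G × B) :=
    ((QuotientGroup.mk' N).comp (MonoidHom.fst G B)).eqLocus (θ.comp (MonoidHom.snd G B))
  have hE : ∀ x : G × B, x ∈ E ↔ ((x.1 : G) : G ⧸ N) = θ x.2 := fun x => Iff.rfl
  let f : E →* G := (MonoidHom.fst G B).comp E.subtype
  have hf : Function.Surjective f := by
    intro g
    obtain ⟨u, hu⟩ := hsurj (g : G ⧸ N)
    exact ⟨⟨(g, u), (hE _).2 hu.symm⟩, rfl⟩
  let Q : Subgroup E := P.comap f
  have hQ : Q.index = P.index := Subgroup.index_comap_of_surjective _ hf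
  let r : Q →* θ.ker :=
    { toFun := fun q => ⟨(π ⟨f q.1, q.2⟩)⁻¹ * q.1.1.2, by
        rw [MonoidHom.mem_ker, map_mul, map_inv, hθ, ← (hE _).1 q.1.2]
        exact inv_mul_cancel _⟩
      map_one' := by
        apply Subtype.ext
        have : (⟨f (1 : Q).1, (1 : Q).2⟩ : P) = 1 := Subtype.ext (map_one f)
        change (π ⟨f (1 : Q).1, (1 : Q).2⟩)⁻¹ * 1 = 1
        rw [this]; simp
      map_mul' := by
        intro a b
        apply Subtype.ext
        have h1 : (⟨f (a * b : Q).1, (a * b : Q).2⟩ : P) = ⟨f a.1, a.2⟩ * ⟨f b.1, b.2⟩ :=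
          Subtype.ext (map_mul f _ _)
        change (π ⟨f (a * b : Q).1, (a * b : Q).2⟩)⁻¹ * (a.1.1.2 * b.1.1.2) =
          ((π ⟨f a.1, a.2⟩)⁻¹ * a.1.1.2) * ((π ⟨f b.1, b.2⟩)⁻¹ * b.1.1.2)
        have h2 := hc ((π ⟨f a.1, a.2⟩)⁻¹ * a.1.1.2) (by
          rw [MonoidHom.mem_ker, map_mul, map_inv, hθ, ← (hE _).1 a.1.2]
          exact inv_mul_cancel _) ((π ⟨f b.1, b.2⟩)⁻¹)
        rw [h1, map_mul, mul_inv_rev, ← mul_assoc ((π ⟨f a.1, a.2⟩)⁻¹ * a.1.1.2), h2]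
        group }
  have hfin : Q.FiniteIndex := inferInstance
  let V : E →* θ.ker := MonoidHom.transfer r
  let ιN : N →* E :=
    { toFun := fun n => ⟨((n : G), 1), (hE _).2 (by
        rw [map_one]; exact (QuotientGroup.eq_one_iff _).2 n.2)⟩
      map_one' := rfl
      map_mul' := fun a b => Subtype.ext (Prod.ext rfl (one_mul 1).symm) }
  let ιP : P →* E :=
    { toFun := fun y => ⟨((y : G), π y), (hE _).2 (hθ y).symm⟩
      map_one' := Subtype.ext (Prod.ext rfl (map_one π))
      map_mul' := fun a b => Subtype.ext (Prod.ext rfl (map_mul π a b)) }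
  refine ⟨V.comp ιN, V.comp ιP, ?_, ?_⟩
  · intro h n n' hn
    obtain ⟨⟨e, he⟩, rfl⟩ := hf h
    have : ιN n' = ⟨e, he⟩ * ιN n * ⟨e, he⟩⁻¹ := by
      apply Subtype.ext
      apply Prod.ext
      · exact hn
      · change (1 : B) = e.2 * 1 * e.2⁻¹
        simp
    change V (ιN n') = V (ιN n)
    rw [this, map_mul, map_mul, map_inv, mul_comm (V ⟨e, he⟩), mul_inv_cancel_right]
  · intro y n z hy hz
    have hzE : ((1 : G), (z : B)) ∈ E := (hE _).2 (z.2).symm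
    have h1 : ιP y = ιN n * ⟨(1, z), hzE⟩ := by
      apply Subtype.ext
      apply Prod.ext
      · change (y : G) = n * 1
        rw [mul_one, hy]
      · change π y = 1 * z
        rw [one_mul, hz]
    have key : ∀ (k : ℕ) (g₀ : E), g₀⁻¹ * (⟨(1, z), hzE⟩ : E) ^ k * g₀ ∈ Q →
        g₀⁻¹ * (⟨(1, z), hzE⟩ : E) ^ k * g₀ = (⟨(1, z), hzE⟩ : E) ^ k := by
      intro k g₀ _
      have : (⟨(1, z), hzE⟩ : E) ^ k * g₀ = g₀ * (⟨(1, z), hzE⟩ : E) ^ k := by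
        have : Commute (⟨(1, z), hzE⟩ : E) g₀ := by
          apply Subtype.ext
          apply Prod.ext
          · change 1 * g₀.1.1 = g₀.1.1 * 1
            simp
          · exact hc z z.2 g₀.1.2
        exact (this.pow_left k).eq
      rw [mul_assoc, this, inv_mul_cancel_left]
    change V (ιP y) = V (ιN n) * z ^ P.index
    rw [h1, map_mul]
    congr 1
    refine (MonoidHom.transfer_eq_pow r _ key).trans ?_
    apply Subtype.ext
    have h2 : ∀ k : ℕ, ((⟨(1, z), hzE⟩ : E) ^ k).1 = ((1 : G), (z : B) ^ k) := by
      intro k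
      rw [Subgroup.coe_pow, Prod.pow_mk, one_pow]
    have h3 : ∀ hm, (⟨f ((⟨(1, z), hzE⟩ : E) ^ Q.index), hm⟩ : P) = 1 := by
      intro hm
      apply Subtype.ext
      change ((⟨(1, z), hzE⟩ : E) ^ Q.index).1.1 = 1
      rw [h2]
    refine (congrArg (fun w : P => (π w)⁻¹ * ((⟨(1, z), hzE⟩ : E) ^ Q.index).1.2)
      (h3 (MonoidHom.transfer_eq_pow_aux _ key))).trans ?_
    rw [h2, hQ]
    simp

theorem aux_inf {G : Type*} [Group G] [Finite G] {p : ℕ} (hp : p.Prime) (P : Sylow p G)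
    (M S : Subgroup G) (hM : M ≤ P) (hMi : M.relIndex P = p) (hMS : M ≤ S) (hS : S.index = p) :
    S ⊓ P ≤ M := by
  have := Fact.mk hp
  have h1 := Subgroup.relIndex_mul_relIndex M (S ⊓ P) P (le_inf hMS hM) inf_le_right
  rw [hMi] at h1
  rcases (Nat.dvd_prime hp).mp (Dvd.intro _ h1) with h | h
  · exact Subgroup.relIndex_eq_one.mp h
  · exfalso
    rw [h] at h1
    have h2 : (S ⊓ P).relIndex P = 1 := by
      have := hp.pos
      nlinarith
    have h3 := Subgroup.relIndex_eq_one.mp h2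
    apply P.not_dvd_index
    have := Subgroup.index_dvd_of_le (h3.trans inf_le_left)
    rwa [hS] at this

theorem aux_sup_top {G : Type*} [Group G] [Finite G] {p : ℕ} (hp : p.Prime) (P : Sylow p G)
    (N : Subgroup G) (hN : ∃ n, N.index = p ^ n) : (P : Subgroup G) ⊔ N = ⊤ := by
  have := Fact.mk hp
  obtain ⟨n, hn⟩ := hN
  rw [← Subgroup.index_eq_one]
  have h1 := Subgroup.index_dvd_of_le (le_sup_left : (P : Subgroup G) ≤ (P : Subgroup G) ⊔ N)
  have h2 := Subgroup.index_dvd_of_le (le_sup_right : N ≤ (P : Subgroup G) ⊔ N)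
  rw [hn] at h2
  have h3 : Nat.Coprime (p ^ n) (P : Subgroup G).index :=
    Nat.Coprime.pow_left _ ((Nat.Prime.coprime_iff_not_dvd hp).2 P.not_dvd_index)
  exact Nat.eq_one_of_dvd_coprimes h3 h2 h1

theorem aux_tate {G : Type*} [Group G] [Finite G] {p : ℕ} (hp : p.Prime) (P : Sylow p G)
    (h : ∀ M : Subgroup G, M ≤ P → M.relIndex P = p → ∃ S : Subgroup G, M ≤ S ∧ S.Normal ∧
      S.index = p) :
    ∃ K : Subgroup G, K.Normal ∧ K ⊓ P = ⊥ ∧ ∃ n, K.index = p ^ n := by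
  have := Fact.mk hp
  obtain ⟨N, ⟨hNn, hNi⟩, hmin⟩ := Set.Finite.exists_minimal
    (s := {N : Subgroup G | N.Normal ∧ ∃ n, N.index = p ^ n}) (Set.toFinite _)
    ⟨⊤, inferInstance, 0, by simp⟩
  refine ⟨N, hNn, ?_, hNi⟩
  by_contra hne
  have hsup := aux_sup_top hp P N hNi
  let Y : Subgroup P := N.subgroupOf P
  have hY : Y ≠ ⊥ := by
    intro h
    apply hne
    rw [← disjoint_iff]
    exact Subgroup.subgroupOf_eq_bot.mp h
  obtain ⟨X, hXn, hXY, hXi, hXc⟩ := aux_step hp P.2 Y hY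
  let π : P →* P ⧸ X := QuotientGroup.mk' X
  let θ : P ⧸ X →* G ⧸ N := QuotientGroup.map X N (P : Subgroup G).subtype hXY
  have hθ : ∀ y : P, θ (π y) = ((y : G) : G ⧸ N) := fun y => rfl
  have hker : ∀ y : P, π y ∈ θ.ker ↔ y ∈ Y := by
    intro y
    rw [MonoidHom.mem_ker, hθ, QuotientGroup.eq_one_iff]
    rfl
  have hsurj : Function.Surjective θ := by
    intro g
    obtain ⟨g, rfl⟩ := QuotientGroup.mk_surjective g
    have : g ∈ (P : Subgroup G) ⊔ N := by rw [hsup]; trivial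
    obtain ⟨y, hy, n, hn, rfl⟩ := Subgroup.mem_sup_of_normal_right.mp this
    refine ⟨π ⟨y, hy⟩, ?_⟩
    rw [hθ, QuotientGroup.mk_mul, (QuotientGroup.eq_one_iff n).2 hn, mul_one]
  have hc : ∀ z ∈ θ.ker, ∀ b, z * b = b * z := by
    intro z hz b
    obtain ⟨y, rfl⟩ := QuotientGroup.mk'_surjective X z
    obtain ⟨g, rfl⟩ := QuotientGroup.mk'_surjective X b
    have h1 := hXc y ((hker y).1 hz) g
    have h2 : π (y * g * y⁻¹ * g⁻¹) = 1 := (QuotientGroup.eq_one_iff _).2 h1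
    rw [map_mul, map_mul, map_mul, map_inv, map_inv, mul_inv_eq_one, mul_inv_eq_iff_eq_mul] at h2
    exact h2
  have hcard : Nat.card θ.ker = p := by
    have h1 : Y.map π = θ.ker := by
      ext z
      obtain ⟨y, rfl⟩ := QuotientGroup.mk'_surjective X z
      constructor
      · rintro ⟨y', hy', h⟩
        rw [← h]
        exact (hker y').2 hy'
      · intro h
        exact ⟨y, (hker y).1 h, rfl⟩
    rw [← h1, ← Subgroup.relIndex_ker, QuotientGroup.ker_mk', hXi]
  obtain ⟨W, δ, hW, hδ⟩ := aux_tate_step (P : Subgroup G) N π θ hθ hsurj hc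
  -- subgroups of `N` that are normal of `p`-power relative index are everything
  have hminN : ∀ K : Subgroup G, K.Normal → K ≤ N → K.relIndex N ∣ p → N ≤ K := by
    intro K hK hKN hKi
    apply hmin ⟨hK, ?_⟩ hKN
    obtain ⟨n, hn⟩ := hNi
    rw [← Subgroup.relIndex_mul_index hKN, hn]
    rcases (Nat.dvd_prime hp).mp hKi with h | h
    · exact ⟨n, by rw [h, one_mul]⟩
    · exact ⟨n + 1, by rw [h, pow_succ, mul_comm]⟩
  have hW1 : ∀ n : N, W n = 1 := by
    have hle : W.ker.map N.subtype ≤ N := Subgroup.map_subtype_le _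
    have := hminN (W.ker.map N.subtype) ⟨?_⟩ hle ?_
    · intro n
      obtain ⟨n', hn', h⟩ := this n.2
      rwa [← Subtype.ext h]
    · rintro _ ⟨n, hn, rfl⟩ g
      refine ⟨⟨g * n * g⁻¹, hNn.conj_mem _ n.2 g⟩, ?_, rfl⟩
      exact (hW g n _ rfl).trans hn
    · rw [Subgroup.relIndex, Subgroup.subgroupOf, Subgroup.comap_map_eq_self_of_injective
        N.subtype_injective, Subgroup.index_ker]
      exact (Subgroup.card_subgroup_dvd_card _).trans hcard.dvd
  have hδ1 : ∀ y ∈ Y, δ y = 1 := by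
    intro y hy
    by_cases htop : δ.ker = ⊤
    · have : y ∈ δ.ker := by rw [htop]; trivial
      exact this
    have hi : δ.ker.index = p := by
      have h1 : δ.ker.index ∣ p := by
        rw [Subgroup.index_ker]
        exact (Subgroup.card_subgroup_dvd_card _).trans hcard.dvd
      exact ((Nat.dvd_prime hp).mp h1).resolve_left fun h => htop (Subgroup.index_eq_one.mp h)
    have hMle : δ.ker.map (P : Subgroup G).subtype ≤ P := Subgroup.map_subtype_le _
    have hMi : (δ.ker.map (P : Subgroup G).subtype).relIndex P = p := by
      rw [Subgroup.relIndex, Subgroup.subgroupOf, Subgroup.comap_map_eq_self_of_injective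
        (P : Subgroup G).subtype_injective, hi]
    obtain ⟨S, hMS, hSn, hSi⟩ := h _ hMle hMi
    have hNS : N ≤ N ⊓ S := by
      apply hminN _ inferInstance inf_le_left
      rw [Subgroup.inf_relIndex_left, ← hSi]
      exact Subgroup.relIndex_dvd_index_of_normal _ _
    have hyS : (y : G) ∈ S ⊓ (P : Subgroup G) := ⟨(hNS hy).2, y.2⟩
    obtain ⟨y', hy', h'⟩ := aux_inf hp P _ S hMle hMi hMS hSi hyS
    rw [← Subtype.ext h']
    exact hy'
  have hYX : Y ≤ X := by
    intro y hy
    have h1 := hδ y ⟨y, hy⟩ ⟨π y, (hker y).2 hy⟩ rfl rfl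
    rw [hW1, hδ1 y hy, one_mul] at h1
    have h2 : (⟨π y, (hker y).2 hy⟩ : θ.ker) = 1 := by
      have h3 := orderOf_dvd_of_pow_eq_one h1.symm
      have h4 := orderOf_dvd_natCard (⟨π y, (hker y).2 hy⟩ : θ.ker)
      rw [hcard] at h4
      rw [← orderOf_eq_one_iff]
      exact Nat.eq_one_of_dvd_coprimes ((Nat.Prime.coprime_iff_not_dvd hp).2 P.not_dvd_index) h4 h3
    have h5 : π y = 1 := congrArg Subtype.val h2
    exact (QuotientGroup.eq_one_iff y).1 h5
  have := Subgroup.relIndex_eq_one.mpr hYX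
  rw [hXi] at this
  exact hp.one_lt.ne' this

def PropP (G : Type*) [Group G] : Prop :=
  ∀ p : ℕ, p.Prime → ∃ P : Sylow p G, IsCyclic P ∨
    ∀ M : Subgroup G, M ≤ P → M.relIndex P = p → ∃ S : Subgroup G, M ≤ S ∧ S.index = p

theorem aux_relIndex_dvd {G : Type*} [Group G] [Finite G] (K S : Subgroup G) [K.Normal] :
    S.relIndex K ∣ S.index := by
  have h1 := Subgroup.relIndex_mul_index (inf_le_left : S ⊓ K ≤ S)
  have h2 := Subgroup.relIndex_mul_index (inf_le_right : S ⊓ K ≤ K)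
  rw [Subgroup.inf_relIndex_left] at h1
  rw [Subgroup.inf_relIndex_right] at h2
  obtain ⟨t, ht⟩ := Subgroup.relIndex_dvd_index_of_normal K S
  have h3 : K.relIndex S ≠ 0 := (Subgroup.index_ne_zero_of_finite (H := K.subgroupOf S))
  refine ⟨t, ?_⟩
  apply Nat.eq_of_mul_eq_mul_left (Nat.pos_of_ne_zero h3)
  rw [h1, ← h2, ht]
  ring

theorem PropP.normal {G : Type*} [Group G] [Finite G] (hG : PropP G) (K : Subgroup G) [K.Normal]
    {p n : ℕ} (hp : p.Prime) (hKi : K.index = p ^ n) (hK : ¬ p ∣ Nat.card K) : PropP K := by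
  intro q hq
  have := Fact.mk hq
  have := Fact.mk hp
  by_cases hqp : q = p
  · subst hqp
    obtain ⟨P⟩ : Nonempty (Sylow q K) := inferInstance
    refine ⟨P, Or.inl ?_⟩
    obtain h | h := P.2.card_eq_or_dvd
    · have : Subsingleton P := (Nat.card_eq_one_iff_unique.mp h).1
      infer_instance
    · exact absurd (h.trans (Subgroup.card_subgroup_dvd_card _)) hK
  obtain ⟨P, hP⟩ := hG q hq
  have hPK : (P : Subgroup G) ≤ K := by
    rw [← Subgroup.relIndex_eq_one]
    have h1 := Subgroup.relIndex_dvd_index_of_normal K (P : Subgroup G)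
    have h2 := Subgroup.relIndex_dvd_card K (P : Subgroup G)
    obtain ⟨m, hm⟩ := IsPGroup.iff_card.mp P.2
    rw [hKi] at h1
    rw [hm] at h2
    exact Nat.eq_one_of_dvd_coprimes (Nat.coprime_pow_primes n m hp hq (Ne.symm hqp)) h1 h2
  refine ⟨P.subtype hPK, ?_⟩
  rcases hP with hP | hP
  · left
    exact isCyclic_of_surjective (Subgroup.subgroupOfEquivOfLe hPK).symm
      (Subgroup.subgroupOfEquivOfLe hPK).symm.surjective
  · right
    intro M hM hMi
    have hPm : ((P.subtype hPK : Sylow q K) : Subgroup K).map K.subtype = P := by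
      rw [Sylow.coe_subtype, Subgroup.map_subgroupOf_eq_of_le hPK]
    obtain ⟨S, hMS, hS⟩ := hP (M.map K.subtype) (by rw [← hPm]; exact Subgroup.map_mono hM) (by
      rw [← hPm, Subgroup.relIndex_map_map_of_injective _ _ K.subtype_injective, hMi])
    refine ⟨S.subgroupOf K, Subgroup.map_le_iff_le_comap.mp hMS, ?_⟩
    change S.relIndex K = q
    have h1 := aux_relIndex_dvd K S
    rw [hS] at h1
    refine ((Nat.dvd_prime hq).mp h1).resolve_left fun h => ?_
    have h2 := Subgroup.index_dvd_of_le (Subgroup.relIndex_eq_one.mp h)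
    rw [hS, hKi] at h2
    exact hqp ((Nat.prime_dvd_prime_iff_eq hq hp).mp (hq.dvd_of_dvd_pow h2))

theorem PropP.quot {G : Type*} [Group G] [Finite G] (hG : PropP G) (L : Subgroup G) [L.Normal]
    {r : ℕ} (hr : r.Prime) (hL : IsPGroup r L) : PropP (G ⧸ L) := by
  intro q hq
  have := Fact.mk hq
  have := Fact.mk hr
  obtain ⟨P, hP⟩ := hG q hq
  have hsurj := QuotientGroup.mk'_surjective L
  refine ⟨P.mapSurjective hsurj, ?_⟩
  rcases hP with hP | hP
  · left
    exact isCyclic_of_surjective ((QuotientGroup.mk' L).subgroupMap (P : Subgroup G))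
      ((QuotientGroup.mk' L).subgroupMap_surjective P)
  · right
    intro M hM hMi
    rw [Sylow.coe_mapSurjective] at hM hMi
    have hi : (M.comap (QuotientGroup.mk' L) ⊓ (P : Subgroup G)).relIndex P = q := by
      rw [Subgroup.inf_relIndex_right, Subgroup.relIndex_comap, hMi]
    obtain ⟨S, hMS, hS⟩ := hP (M.comap (QuotientGroup.mk' L) ⊓ P) inf_le_right hi
    have hLS : L ≤ S := by
      by_cases hqr : q = r
      · subst hqr
        refine le_trans (le_inf ?_ (hL.le_sylow_of_normal P)) hMS
        intro x hx
        have : (QuotientGroup.mk' L) x = 1 := (QuotientGroup.eq_one_iff x).2 hx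
        rw [Subgroup.mem_comap, this]
        exact one_mem _
      · rw [← Subgroup.relIndex_eq_one]
        have h1 := aux_relIndex_dvd L S
        have h2 := Subgroup.relIndex_dvd_card S L
        obtain ⟨m, hm⟩ := IsPGroup.iff_card.mp hL
        rw [hS] at h1
        rw [hm] at h2
        exact Nat.eq_one_of_dvd_coprimes
          (Nat.Coprime.pow_right m ((Nat.coprime_primes hq hr).2 hqr)) h1 h2
    refine ⟨S.map (QuotientGroup.mk' L), ?_, ?_⟩
    · intro x hx
      obtain ⟨y, hy, rfl⟩ := hM hx
      exact ⟨y, hMS ⟨hx, hy⟩, rfl⟩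
    · rw [Subgroup.index_map_eq S hsurj (by rwa [QuotientGroup.ker_mk']), hS]

theorem PropP.complement {G : Type*} [Group G] [Finite G] (hG : PropP G)
    (h1 : Nat.card G ≠ 1) : ∃ K : Subgroup G, K.Normal ∧
      ¬ (Nat.card G).minFac ∣ Nat.card K ∧ ∃ n, K.index = (Nat.card G).minFac ^ n := by
  have hp := Nat.minFac_prime h1
  have := Fact.mk hp
  obtain ⟨P, hP⟩ := hG _ hp
  have : ∃ K : Subgroup G, K.Normal ∧ K ⊓ P = ⊥ ∧ ∃ n, K.index = (Nat.card G).minFac ^ n := by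
    rcases hP with hP | hP
    · have h := IsCyclic.isComplement' rfl hP
      refine ⟨_, inferInstance, disjoint_iff.mp h.disjoint, ?_⟩
      rw [h.symm.index_eq_card]
      exact IsPGroup.iff_card.mp P.2
    · apply aux_tate hp P
      intro M hM hMi
      obtain ⟨S, hMS, hS⟩ := hP M hM hMi
      exact ⟨S, hMS, Subgroup.normal_of_index_eq_minFac_card hS, hS⟩
  obtain ⟨K, hK, hKP, hKi⟩ := this
  refine ⟨K, hK, fun hd => P.not_dvd_index (hd.trans ?_), hKi⟩
  have h2 : Nat.card P ∣ K.index := by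
    have h3 := Subgroup.relIndex_dvd_index_of_normal K (P : Subgroup G)
    rwa [← Subgroup.inf_relIndex_right, hKP, Subgroup.relIndex_bot_left] at h3
  obtain ⟨t, ht⟩ := h2
  have h4 := K.card_mul_index
  have h5 := (P : Subgroup G).card_mul_index
  refine ⟨t, ?_⟩
  apply Nat.eq_of_mul_eq_mul_left (Nat.card_pos (α := P))
  exact h5.trans (h4.symm.trans (by rw [ht]; ring))

theorem PropP.tower (n : ℕ) : ∀ {G : Type*} [Group G] [Finite G], PropP G → Nat.card G = n →
    n ≠ 1 → ∃ r : ℕ, r.Prime ∧ ∃ R : Sylow r G, (R : Subgroup G).Normal ∧ (R : Subgroup G) ≠ ⊥ := by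
  induction n using Nat.strong_induction_on with
  | _ n ih =>
  intro G _ _ hG hn h1
  subst hn
  obtain ⟨K, hKn, hpK, m, hKi⟩ := hG.complement h1
  have hp := Nat.minFac_prime h1
  have hpf := Fact.mk hp
  by_cases hK : K = ⊥
  · obtain ⟨P⟩ : Nonempty (Sylow (Nat.card G).minFac G) := inferInstance
    have h2 := aux_sup_top hp P K ⟨m, hKi⟩
    rw [hK, sup_bot_eq] at h2
    refine ⟨_, hp, P, by rw [h2]; infer_instance, ?_⟩
    rw [h2]
    intro h
    apply h1
    rw [← Subgroup.card_top (G := G), h, Subgroup.card_bot]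
  · have hlt : Nat.card K < Nat.card G := by
      refine lt_of_le_of_ne (Subgroup.card_le_card_group K) fun h => hpK ?_
      rw [h]
      exact Nat.minFac_dvd _
    obtain ⟨r, hr, R, hRn, hR⟩ := ih _ hlt (hG.normal K hp hKi hpK) rfl
      (fun h => hK (Subgroup.card_eq_one.mp h))
    have hrf := Fact.mk hr
    have hchar : (R : Subgroup K).Characteristic := R.characteristic_of_normal hRn
    have hrp : r ≠ (Nat.card G).minFac := by
      intro h
      obtain h3 | h3 := R.2.card_eq_or_dvd
      · exact hR (Subgroup.card_eq_one.mp h3)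
      · exact hpK (h ▸ h3.trans (Subgroup.card_subgroup_dvd_card _))
    have hni : ¬ r ∣ ((R : Subgroup K).map K.subtype).index := by
      rw [Subgroup.index_map_subtype, hKi]
      intro h
      rcases hr.dvd_mul.mp h with h | h
      · exact R.not_dvd_index h
      · exact hrp ((Nat.prime_dvd_prime_iff_eq hr hp).mp (hr.dvd_of_dvd_pow h))
    refine ⟨r, hr, (R.2.map K.subtype).toSylow hni, ?_, ?_⟩
    · rw [IsPGroup.toSylow_coe]
      exact ConjAct.normal_of_characteristic_of_normal
    · rw [IsPGroup.toSylow_coe]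
      intro h
      exact hR ((Subgroup.map_eq_bot_iff_of_injective _ K.subtype_injective).mp h)

theorem aux_A {G : Type*} [Group G] [Finite G] (R M : Subgroup G) [R.Normal] [M.Normal]
    {r : ℕ} (hr : r.Prime) (h : M.relIndex R = r) :
    ∃ ψ : G →* (ZMod r)ˣ, ∀ g, ψ g = 1 → ∀ x ∈ R, g * x * g⁻¹ * x⁻¹ ∈ M := by
  have hcard : Nat.card (R.map (QuotientGroup.mk' M)) = r := by
    rw [← h]
    have := Subgroup.relIndex_ker R (QuotientGroup.mk' M)
    rw [QuotientGroup.ker_mk'] at this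
    exact this.symm
  have hQ : (R.map (QuotientGroup.mk' M)).Normal :=
    Subgroup.Normal.map inferInstance _ (QuotientGroup.mk'_surjective M)
  clear h
  subst hcard
  have := Fact.mk hr
  have hcyc : IsCyclic (R.map (QuotientGroup.mk' M)) := isCyclic_of_prime_card rfl
  refine ⟨(IsCyclic.mulAutMulEquiv (R.map (QuotientGroup.mk' M))).toMonoidHom.comp
    (MulAut.conjNormal.comp (QuotientGroup.mk' M)), ?_⟩
  intro g hg x hx
  have h1 : MulAut.conjNormal (QuotientGroup.mk' M g) =
      (1 : MulAut (R.map (QuotientGroup.mk' M))) := by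
    apply (IsCyclic.mulAutMulEquiv (R.map (QuotientGroup.mk' M))).injective
    rw [map_one]
    exact hg
  have h2 := congrArg (fun f : MulAut (R.map (QuotientGroup.mk' M)) =>
    ((f ⟨QuotientGroup.mk' M x, x, hx, rfl⟩ : R.map (QuotientGroup.mk' M)) : G ⧸ M)) h1
  simp only [MulAut.conjNormal_apply, MulAut.one_apply] at h2
  rw [← QuotientGroup.eq_one_iff]
  have h3 : (QuotientGroup.mk' M) (g * x * g⁻¹ * x⁻¹) = 1 := by
    rw [map_mul, map_mul, map_mul, map_inv, map_inv, h2, mul_inv_cancel]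
  exact h3

theorem aux_B {G : Type*} [Group G] [Finite G] (R : Subgroup G) [R.Normal] {r q n : ℕ}
    (hr : r.Prime) (hq : q.Prime) (hqr : q ≠ r) (hR : IsPGroup r R)
    (hnorm : ∀ M ≤ R, M.relIndex R = r → M.Normal) (c : G) (hcq : c ^ q ^ n = 1)
    (hc : ∀ M ≤ R, M.relIndex R = r → ∀ x ∈ R, c * x * c⁻¹ * x⁻¹ ∈ M) :
    ∀ x ∈ R, c * x * c⁻¹ = x := by
  by_contra! hcon
  obtain ⟨z, hzR, hz⟩ := hcon
  have hrf := Fact.mk hr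
  have hqf := Fact.mk hq
  obtain ⟨M', hM', hM'i⟩ := aux_exists_index hr hR ((Subgroup.centralizer {c}).subgroupOf R) (by
    rw [Ne, Subgroup.subgroupOf_eq_top]
    intro h
    have := Subgroup.mem_centralizer_singleton_iff.mp (h hzR)
    apply hz
    rw [mul_inv_eq_iff_eq_mul]
    exact this.symm)
  have hMR : M'.map R.subtype ≤ R := Subgroup.map_subtype_le _
  have hMi : (M'.map R.subtype).relIndex R = r := by
    rw [Subgroup.relIndex, Subgroup.subgroupOf, Subgroup.comap_map_eq_self_of_injective
      R.subtype_injective, hM'i]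
  have hTM : ∀ y ∈ R, c * y * c⁻¹ = y → y ∈ M'.map R.subtype := by
    intro y hy hcy
    refine ⟨⟨y, hy⟩, hM' ?_, rfl⟩
    rw [Subgroup.mem_subgroupOf, Subgroup.mem_centralizer_singleton_iff]
    exact (mul_inv_eq_iff_eq_mul.mp hcy).symm
  have hMp : IsPGroup r (M'.map R.subtype) := (hR.to_subgroup M').map R.subtype
  generalize M'.map R.subtype = M at hMR hMi hTM hMp
  have hMn := hnorm M hMR hMi
  have hcM := hc M hMR hMi
  obtain ⟨x, hxR, hxM⟩ : ∃ x ∈ R, x ∉ M := by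
    by_contra! h
    rw [Subgroup.relIndex_eq_one.mpr h] at hMi
    exact hr.one_lt.ne hMi
  have hstab : ∀ y, x⁻¹ * y ∈ M → x⁻¹ * (c * y * c⁻¹) ∈ M := by
    intro y hy
    have h1 := hMn.conj_mem _ (hcM x hxR) x⁻¹
    have h2 := hMn.conj_mem _ hy c
    have := mul_mem h1 h2
    convert this using 1
    group
  have hstab' : ∀ y, x⁻¹ * (c * y * c⁻¹) ∈ M ↔ x⁻¹ * y ∈ M := by
    refine fun y => ⟨fun hy => ?_, hstab y⟩
    have h1 := hMn.conj_mem _ (inv_mem (hcM x hxR)) x⁻¹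
    have h2 := mul_mem h1 hy
    have h3 := hMn.conj_mem _ h2 c⁻¹
    have h4 := hMn.conj_mem _ (hcM x hxR) x⁻¹
    have h5 : x⁻¹ * c⁻¹ * x * c ∈ M := by
      have := hMn.conj_mem _ (inv_mem h4) (c⁻¹ )
      have h6 := hMn.conj_mem _ (inv_mem (hcM x hxR)) (x⁻¹ * c⁻¹)
      convert h6 using 1
      group
    have h7 := hMn.conj_mem _ hy c⁻¹
    have h8 := mul_mem h5 h7
    convert h8 using 1
    group
  let τ : Equiv.Perm {y // x⁻¹ * y ∈ M} :=
    Equiv.Perm.subtypePerm (MulAut.conj c).toEquiv (fun y => hstab' y)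
  have := Fintype.ofFinite {y // x⁻¹ * y ∈ M}
  have hcard : ¬ q ∣ Fintype.card {y // x⁻¹ * y ∈ M} := by
    rw [← Nat.card_eq_fintype_card]
    have e : {y // x⁻¹ * y ∈ M} ≃ M := (Equiv.mulLeft x⁻¹).subtypeEquiv (fun y => Iff.rfl)
    rw [Nat.card_congr e]
    obtain ⟨m, hm⟩ := IsPGroup.iff_card.mp hMp
    rw [hm]
    intro h
    exact hqr ((Nat.prime_dvd_prime_iff_eq hq hr).mp (hq.dvd_of_dvd_pow h))
  have hpow : ∀ (k : ℕ) (y : {y // x⁻¹ * y ∈ M}), (((τ ^ k) y : {y // x⁻¹ * y ∈ M}) : G) =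
      c ^ k * y * (c ^ k)⁻¹ := by
    intro k
    induction k with
    | zero => intro y; simp
    | succ k ih =>
      intro y
      rw [pow_succ, Equiv.Perm.mul_apply, ih]
      change c ^ k * (c * y * c⁻¹) * (c ^ k)⁻¹ = _
      rw [pow_succ]
      group
  obtain ⟨⟨y, hy⟩, hfix⟩ := Equiv.Perm.exists_fixed_point_of_prime (σ := τ) (n := n) hcard (by
    ext y
    rw [hpow, hcq]
    simp)
  have hfix' : c * y * c⁻¹ = y := congrArg Subtype.val hfix
  have hyR : y ∈ R := by
    have := mul_mem hxR (hMR hy)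
    rwa [mul_inv_cancel_left] at this
  have := mul_mem (hTM y hyR hfix') (inv_mem hy)
  apply hxM
  convert this using 1
  group

theorem aux_C {G : Type*} [Group G] [Finite G] {r : ℕ} (hr : r.Prime) (R : Sylow r G)
    (hRn : (R : Subgroup G).Normal)
    (hnorm : ∀ M ≤ (R : Subgroup G), M.relIndex R = r → M.Normal) (C L : Subgroup G)
    (hLR : L ≤ R) (hL : ∀ l ∈ L, ∀ x ∈ R, x * l * x⁻¹ = l)
    (hC : ∀ c ∈ C, ∀ M ≤ (R : Subgroup G), M.relIndex R = r → ∀ x ∈ R, c * x * c⁻¹ * x⁻¹ ∈ M) :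
    ∀ c ∈ C, ∀ l ∈ L, c * l * c⁻¹ = l := by
  have hrf := Fact.mk hr
  have key : (Subgroup.centralizer (L : Set G)).subgroupOf C = ⊤ := by
    apply aux_eq_top_of_sylow
    intro q hq P c hc
    rw [Subgroup.mem_subgroupOf, Subgroup.mem_centralizer_iff]
    intro l hl
    suffices h : (c : G) * l * (c : G)⁻¹ = l from (mul_inv_eq_iff_eq_mul.mp h).symm
    have hqf := Fact.mk hq
    by_cases hqr : q = r
    · subst hqr
      apply hL l hl
      obtain ⟨Q, hQ⟩ := (P.2.map C.subtype).exists_le_sylow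
      have : Subsingleton (Sylow q G) := (Sylow.unique_of_normal R hRn).instSubsingleton
      rw [Subsingleton.elim R Q]
      exact hQ ⟨c, hc, rfl⟩
    · obtain ⟨n, hn⟩ := P.2 ⟨c, hc⟩
      have hn' : (c : G) ^ q ^ n = 1 := by
        have := congrArg (fun z : P => ((z : C) : G)) hn
        simpa using this
      exact aux_B (R : Subgroup G) hr hq hqr R.2 hnorm c hn' (hC c c.2) l (hLR hl)
  intro c hc l hl
  have := Subgroup.subgroupOf_eq_top.mp key hc
  rw [Subgroup.mem_centralizer_iff] at this
  rw [mul_inv_eq_iff_eq_mul]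
  exact (this l hl).symm

theorem aux_E {V : Type*} [CommGroup V] [Finite V] [Nontrivial V] {r : ℕ} (hr : r.Prime)
    (hV : ∀ x : V, x ^ r = 1) (f : MulAut V) (hf : f ^ (r - 1) = 1) :
    ∃ x : V, x ≠ 1 ∧ ∃ n : ℕ, f x = x ^ n := by
  have hrf := Fact.mk hr
  let _ : Module (ZMod r) (Additive V) := AddCommGroup.zmodModule (n := r) (fun x => hV x.toMul)
  have : Finite (Additive V) := ‹Finite V›
  have : Module.Finite (ZMod r) (Additive V) := Module.Finite.of_finite
  let F : Module.End (ZMod r) (Additive V) :=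
    AddMonoidHom.toZModLinearMap r (MonoidHom.toAdditive f.toMonoidHom)
  have hF : ∀ x : V, F (Additive.ofMul x) = Additive.ofMul (f x) := fun x => rfl
  have hFp : ∀ (k : ℕ) (x : V), (F ^ k) (Additive.ofMul x) = Additive.ofMul ((f ^ k) x) := by
    intro k
    induction k with
    | zero => intro x; simp
    | succ k ih => intro x; rw [pow_succ, Module.End.mul_apply, hF, ih, pow_succ, MulAut.mul_apply]
  have hF1 : F ^ r = F := by
    ext x
    have := hFp r x.toMul
    have h2 : f ^ r = f := by
      conv_lhs => rw [← Nat.sub_add_cancel hr.one_lt.le, pow_succ, hf, one_mul]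
    rw [h2] at this
    exact this
  have hdvd : minpoly (ZMod r) F ∣ (Polynomial.X ^ r - Polynomial.X) := by
    apply minpoly.dvd
    simp [hF1]
  have hsp : (Polynomial.X ^ r - Polynomial.X : Polynomial (ZMod r)).Splits := by
    have := FiniteField.splits_X_pow_card_sub_X (K := ZMod r) r
    simpa using this
  have hne : (Polynomial.X ^ r - Polynomial.X : Polynomial (ZMod r)) ≠ 0 :=
    FiniteField.X_pow_card_sub_X_ne_zero _ hr.one_lt
  have hs2 := hsp.of_dvd hne hdvd
  have hint : IsIntegral (ZMod r) F := Algebra.IsIntegral.isIntegral F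
  obtain ⟨a, ha⟩ := hs2.exists_eval_eq_zero (minpoly.degree_pos hint).ne'
  have hev := Module.End.hasEigenvalue_of_isRoot (f := F) ha
  obtain ⟨v, hv⟩ := hev.exists_hasEigenvector
  refine ⟨v.toMul, fun h => hv.2 (by exact h), a.val, ?_⟩
  have h1 : F v = a • v := hv.apply_eq_smul
  have h2 : a • v = a.val • v := by
    conv_lhs => rw [← ZMod.natCast_zmod_val a]
    exact Nat.cast_smul_eq_nsmul _ _ _
  rw [h2] at h1
  exact h1

/-- the elements acting trivially on all `R / M`. -/
def auxC {G : Type*} [Group G] (R : Subgroup G) (r : ℕ)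
    (hnorm : ∀ M ≤ R, M.relIndex R = r → M.Normal) : Subgroup G where
  carrier := {c | ∀ M ≤ R, M.relIndex R = r → ∀ x ∈ R, c * x * c⁻¹ * x⁻¹ ∈ M}
  one_mem' := by
    intro M hM hi x hx
    simp
  mul_mem' := by
    intro c d hc hd M hM hi x hx
    have h := mul_mem ((hnorm M hM hi).conj_mem _ (hd M hM hi x hx) c) (hc M hM hi x hx)
    convert h using 1
    group
  inv_mem' := by
    intro c hc M hM hi x hx
    have h := (hnorm M hM hi).conj_mem _ (inv_mem (hc M hM hi x hx)) c⁻¹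
    convert h using 1
    group

theorem aux_maxnormal {G : Type*} [Group G] [Finite G] {r : ℕ} (hr : r.Prime) (R : Sylow r G)
    (hRn : (R : Subgroup G).Normal)
    (hR : ∀ M : Subgroup G, M ≤ R → M.relIndex R = r → ∃ S : Subgroup G, M ≤ S ∧ S.index = r) :
    ∀ M ≤ (R : Subgroup G), M.relIndex R = r → M.Normal := by
  intro M hM hMi
  obtain ⟨S, hMS, hS⟩ := hR M hM hMi
  have hMe : M = S ⊓ R := le_antisymm (le_inf hMS hM) (aux_inf hr R M S hM hMi hMS hS)
  have h1 : (M.subgroupOf R).Normal := aux_index_normal hr R.2 _ hMi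
  rw [← Subgroup.normalizer_eq_top_iff, eq_top_iff, ← aux_sup_top hr R S ⟨1, by rw [hS, pow_one]⟩]
  apply sup_le
  · exact Subgroup.normal_subgroupOf_iff_le_normalizer hM |>.mp h1
  · rw [hMe]
    have h2 : ((S ⊓ R).subgroupOf S).Normal := by
      rw [Subgroup.inf_subgroupOf_left]
      infer_instance
    exact Subgroup.normal_subgroupOf_iff_le_normalizer inf_le_left |>.mp h2

theorem aux_central {G : Type*} [Group G] [Finite G] {r : ℕ} (hr : r.Prime) (R : Sylow r G)
    (hRn : (R : Subgroup G).Normal) (L : Subgroup G) [hLn : L.Normal] (hLR : L ≤ R) (hL : L ≠ ⊥)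
    (hmin : ∀ N : Subgroup G, N.Normal → N ≤ L → N = ⊥ ∨ N = L) :
    ∀ l ∈ L, ∀ x ∈ R, x * l * x⁻¹ = l := by
  have hrf := Fact.mk hr
  have : Group.IsNilpotent R := R.2.isNilpotent
  have hle : ⁅L, (R : Subgroup G)⁆ ≤ L := Subgroup.commutator_le_left _ _
  rcases hmin ⁅L, (R : Subgroup G)⁆ inferInstance hle with h | h
  · intro l hl x hx
    have := Subgroup.commutator_mem_commutator hl hx
    rw [h, Subgroup.mem_bot, commutatorElement_eq_one_iff_mul_comm] at this
    rw [mul_inv_eq_iff_eq_mul, this]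
  · exfalso
    apply hL
    have h1 : L.subgroupOf R ≤ ⁅L.subgroupOf R, (⊤ : Subgroup R)⁆ := by
      rw [← Subgroup.map_subtype_le_map_subtype, Subgroup.map_commutator,
        Subgroup.map_subgroupOf_eq_of_le hLR, ← MonoidHom.range_eq_map, Subgroup.range_subtype]
      exact h.ge
    have h2 := aux_comm_eq _ h1
    rw [Subgroup.subgroupOf_eq_bot, disjoint_iff, inf_eq_left.mpr hLR] at h2
    exact h2

theorem aux_min {G : Type*} [Group G] [Finite G] {r : ℕ} (hr : r.Prime) (R : Sylow r G)
    (hRn : (R : Subgroup G).Normal)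
    (hR : ∀ M : Subgroup G, M ≤ R → M.relIndex R = r → ∃ S : Subgroup G, M ≤ S ∧ S.index = r)
    (L : Subgroup G) [hLn : L.Normal] (hLR : L ≤ R) (hL : L ≠ ⊥)
    (hmin : ∀ N : Subgroup G, N.Normal → N ≤ L → N = ⊥ ∨ N = L) :
    ∃ x : G, L = Subgroup.zpowers x := by
  have hrf := Fact.mk hr
  have hnorm := aux_maxnormal hr R hRn hR
  have hcen := aux_central hr R hRn L hLR hL hmin
  have hLc : ∀ a ∈ L, ∀ b ∈ L, a * b = b * a := by
    intro a ha b hb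
    exact mul_inv_eq_iff_eq_mul.mp (hcen b hb a (hLR ha))
  have hC := aux_C hr R hRn hnorm (auxC (R : Subgroup G) r hnorm) L hLR hcen (fun c hc => hc)
  have hcomm : ∀ g h : G, ∀ l ∈ L, (g * h * g⁻¹ * h⁻¹) * l * (g * h * g⁻¹ * h⁻¹)⁻¹ = l := by
    intro g h
    apply hC
    intro M hM hi
    have := hnorm M hM hi
    obtain ⟨ψ, hψ⟩ := aux_A (R : Subgroup G) M hr hi
    apply hψ
    rw [map_mul, map_mul, map_mul, map_inv, map_inv, mul_comm (ψ g), mul_inv_cancel_right,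
      mul_inv_cancel]
  have hpow : ∀ g : G, ∀ l ∈ L, g ^ (r - 1) * l * (g ^ (r - 1))⁻¹ = l := by
    intro g
    apply hC
    intro M hM hi
    have := hnorm M hM hi
    obtain ⟨ψ, hψ⟩ := aux_A (R : Subgroup G) M hr hi
    apply hψ
    rw [map_pow, ZMod.units_pow_card_sub_one_eq_one]
  have hLp : IsPGroup r L := R.2.to_le hLR
  -- elementary abelian
  have hexp : ∀ a ∈ L, a ^ r = 1 := by
    let E : Subgroup G :=
      { carrier := {a | a ∈ L ∧ a ^ r = 1}
        one_mem' := ⟨one_mem _, one_pow _⟩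
        mul_mem' := by
          rintro a b ⟨ha, ha'⟩ ⟨hb, hb'⟩
          refine ⟨mul_mem ha hb, ?_⟩
          rw [(show Commute a b from hLc a ha b hb).mul_pow, ha', hb', one_mul]
        inv_mem' := by
          rintro a ⟨ha, ha'⟩
          exact ⟨inv_mem ha, by rw [inv_pow, ha', inv_one]⟩ }
    have hE : E.Normal := ⟨by
      rintro a ⟨ha, ha'⟩ g
      exact ⟨hLn.conj_mem a ha g, by rw [conj_pow, ha', mul_one, mul_inv_cancel]⟩⟩
    rcases hmin E hE (fun a ha => ha.1) with h | h
    · exfalso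
      obtain h1 | h1 := hLp.card_eq_or_dvd
      · exact hL (Subgroup.card_eq_one.mp h1)
      · obtain ⟨x, hx⟩ := exists_prime_orderOf_dvd_card' r h1
        have h2 : (x : G) ∈ E := ⟨x.2, by
          rw [← hx]
          exact_mod_cast congrArg (Subtype.val) (pow_orderOf_eq_one x)⟩
        rw [h, Subgroup.mem_bot] at h2
        have h3 : x = 1 := Subtype.ext h2
        rw [h3, orderOf_one] at hx
        exact hr.one_lt.ne hx
    · intro a ha
      rw [← h] at ha
      exact ha.2
  have heig : ∀ g : G, ∀ y ∈ L, g * y * g⁻¹ ∈ Subgroup.zpowers y := by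
    intro g
    let _ : CommGroup L := { (inferInstance : Group L) with
      mul_comm := fun a b => Subtype.ext (hLc a a.2 b b.2) }
    have hnt : Nontrivial L := (Subgroup.nontrivial_iff_ne_bot L).mpr hL
    obtain ⟨x, hx1, n, hxn⟩ := aux_E (V := L) hr (fun x => Subtype.ext (hexp x x.2))
      (MulAut.conjNormal g) (by
        rw [← map_pow]
        ext l
        exact hpow g l l.2)
    let E : Subgroup G :=
      { carrier := {a | a ∈ L ∧ g * a * g⁻¹ = a ^ n}
        one_mem' := ⟨one_mem _, by simp⟩
        mul_mem' := by
          rintro a b ⟨ha, ha'⟩ ⟨hb, hb'⟩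
          refine ⟨mul_mem ha hb, ?_⟩
          rw [(show Commute a b from hLc a ha b hb).mul_pow, ← ha', ← hb']
          group
        inv_mem' := by
          rintro a ⟨ha, ha'⟩
          refine ⟨inv_mem ha, ?_⟩
          rw [inv_pow, ← ha']
          group }
    have hE : E.Normal := ⟨by
      rintro a ⟨ha, ha'⟩ h
      refine ⟨hLn.conj_mem a ha h, ?_⟩
      have h1 := hcomm g⁻¹ h⁻¹ a ha
      rw [conj_pow, ← ha']
      conv_rhs => rw [← h1]
      group⟩
    rcases hmin E hE (fun a ha => ha.1) with h | h
    · exfalso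
      have h2 : (x : G) ∈ E := ⟨x.2, by exact congrArg Subtype.val hxn⟩
      rw [h, Subgroup.mem_bot] at h2
      exact hx1 (Subtype.ext h2)
    · intro y hy
      rw [← h] at hy
      rw [hy.2]
      exact Subgroup.npow_mem_zpowers y n
  obtain ⟨x, hxL, hx1⟩ := Subgroup.ne_bot_iff_exists_ne_one.mp hL |>.elim
    (fun x hx => (⟨x, x.2, fun h => hx (Subtype.ext h)⟩ : ∃ x ∈ L, x ≠ 1))
  have hzn : (Subgroup.zpowers x).Normal := ⟨by
    rintro y hy g
    obtain ⟨k, rfl⟩ := Subgroup.mem_zpowers_iff.mp hy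
    rw [← conj_zpow]
    exact zpow_mem (heig g x hxL) k⟩
  refine ⟨x, ?_⟩
  rcases hmin _ hzn (Subgroup.zpowers_le.mpr hxL) with h | h
  · exact absurd (Subgroup.zpowers_eq_bot.mp h) hx1
  · exact h.symm



theorem aux_ss {G : Type*} [Group G] (x : G) (hL : (Subgroup.zpowers x).Normal)
    (h : IsSupersoluble (G ⧸ Subgroup.zpowers x)) : IsSupersoluble G := by
  obtain ⟨n, c, h0, hlast, hn, hle, hg⟩ := h
  have hk : ∀ k, Subgroup.zpowers x ≤ (c k).comap (QuotientGroup.mk' (Subgroup.zpowers x)) := by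
    intro k
    have := (QuotientGroup.mk' (Subgroup.zpowers x)).ker_le_comap (c k)
    rwa [QuotientGroup.ker_mk'] at this
  have h0' : (c 0).comap (QuotientGroup.mk' (Subgroup.zpowers x)) = Subgroup.zpowers x := by
    rw [h0, MonoidHom.comap_bot, QuotientGroup.ker_mk']
  refine ⟨n + 1, Fin.cons ⊥ (fun k => (c k).comap (QuotientGroup.mk' (Subgroup.zpowers x))),
    rfl, ?_, ?_, ?_, ?_⟩
  · rw [← Fin.succ_last, Fin.cons_succ, hlast, Subgroup.comap_top]
  · intro k
    refine Fin.cases ?_ (fun k => ?_) k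
    · rw [Fin.cons_zero]; infer_instance
    · rw [Fin.cons_succ]
      have := hn k
      infer_instance
  · intro k
    refine Fin.cases ?_ (fun k => ?_) k
    · exact bot_le
    · rw [← Fin.succ_castSucc, Fin.cons_succ, Fin.cons_succ]
      exact Subgroup.comap_mono (hle k)
  · intro k
    refine Fin.cases ?_ (fun k => ?_) k
    · refine ⟨x, ?_, ?_⟩
      · rw [Fin.cons_succ, h0']
        exact Subgroup.mem_zpowers x
      · rw [Fin.cons_succ, h0', Fin.castSucc_zero, Fin.cons_zero, bot_sup_eq]
    · rw [← Fin.succ_castSucc, Fin.cons_succ, Fin.cons_succ]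
      obtain ⟨g, hgm, hge⟩ := hg k
      obtain ⟨y, rfl⟩ := QuotientGroup.mk'_surjective _ g
      refine ⟨y, hgm, ?_⟩
      apply le_antisymm
      · exact sup_le (Subgroup.comap_mono (hle k)) (Subgroup.zpowers_le.mpr hgm)
      · rw [← hge, ← MonoidHom.map_zpowers]
        intro z hz
        rw [Subgroup.mem_comap, Subgroup.mem_sup_of_normal_left] at hz
        obtain ⟨a, ha, b, ⟨b', hb', rfl⟩, hab⟩ := hz
        have h1 : z * b'⁻¹ ∈ (c k.castSucc).comap (QuotientGroup.mk' (Subgroup.zpowers x)) := by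
          rw [Subgroup.mem_comap, map_mul, map_inv, ← hab, mul_inv_cancel_right]
          exact ha
        have h2 := Subgroup.mul_mem_sup h1 hb'
        rwa [inv_mul_cancel_right] at h2

theorem PropP.supersoluble (n : ℕ) : ∀ {G : Type*} [Group G] [Finite G], PropP G →
    Nat.card G = n → IsSupersoluble G := by
  induction n using Nat.strong_induction_on with
  | _ n ih =>
  intro G _ _ hG hn
  by_cases h1 : n = 1
  · have : Subsingleton G := (Nat.card_eq_one_iff_unique.mp (hn.trans h1)).1
    refine ⟨0, fun _ => ⊥, rfl, Subsingleton.elim _ _, fun _ => inferInstance, fun k => k.elim0,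
      fun k => k.elim0⟩
  obtain ⟨r, hr, R, hRn, hR⟩ := PropP.tower n hG hn h1
  have hrf := Fact.mk hr
  have hR2 : IsCyclic R ∨ ∀ M : Subgroup G, M ≤ R → M.relIndex R = r →
      ∃ S : Subgroup G, M ≤ S ∧ S.index = r := by
    obtain ⟨R', hR'⟩ := hG r hr
    have : Subsingleton (Sylow r G) := (Sylow.unique_of_normal R hRn).instSubsingleton
    rwa [Subsingleton.elim R R']
  obtain ⟨L, ⟨hLn, hLR, hL⟩, hmin⟩ := Set.Finite.exists_minimal
    (s := {N : Subgroup G | N.Normal ∧ N ≤ R ∧ N ≠ ⊥}) (Set.toFinite _) ⟨R, hRn, le_rfl, hR⟩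
  have hx : ∃ x : G, L = Subgroup.zpowers x := by
    rcases hR2 with hc | hc
    · have : IsCyclic L := isCyclic_of_injective (Subgroup.inclusion hLR)
        (Subgroup.inclusion_injective hLR)
      obtain ⟨x, hx⟩ := (Subgroup.isCyclic_iff_exists_zpowers_eq_top L).mp this
      exact ⟨x, hx.symm⟩
    · refine aux_min hr R hRn hc L hLR hL ?_
      intro N hN hNL
      by_cases hNb : N = ⊥
      · exact Or.inl hNb
      · exact Or.inr (le_antisymm hNL (hmin ⟨hN, hNL.trans hLR, hNb⟩ hNL))
  obtain ⟨x, rfl⟩ := hx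
  apply aux_ss x hLn
  refine ih _ ?_ (hG.quot _ hr (R.2.to_le hLR)) rfl
  rw [← hn, ← Subgroup.card_mul_index (Subgroup.zpowers x)]
  change (Subgroup.zpowers x).index < _
  have h3 : Nat.card (Subgroup.zpowers x) ≠ 1 := fun h => hL (Subgroup.card_eq_one.mp h)
  have h4 : 0 < Nat.card (Subgroup.zpowers x) := Nat.card_pos
  have h5 : 0 < (Subgroup.zpowers x).index :=
    Nat.pos_of_ne_zero Subgroup.index_ne_zero_of_finite
  exact lt_mul_of_one_lt_left h5 (by omega)

theorem aux_coatom {A : Type*} [Group A] [Finite A] (M : Subgroup A) {p : ℕ} (hp : p.Prime)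
    (h : M.index = p) : IsCoatom M := by
  refine ⟨fun h1 => ?_, fun N hN => ?_⟩
  · rw [h1, Subgroup.index_top] at h
    exact hp.one_lt.ne h
  · have h1 := Subgroup.relIndex_mul_index hN.le
    rw [h] at h1
    rcases (Nat.dvd_prime hp).mp (Dvd.intro _ h1) with h2 | h2
    · exact absurd (Subgroup.relIndex_eq_one.mp h2) (not_le_of_gt hN)
    · rw [h2] at h1
      exact Subgroup.index_eq_one.mp (Nat.eq_of_mul_eq_mul_left hp.pos (h1.trans (mul_one p).symm))

theorem aux_nilp_normal {A : Type*} [Group A] [Finite A] [Group.IsNilpotent A] {p : ℕ}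
    (hp : p.Prime) (P : Sylow p A) (N : Subgroup A) (hN : N ≤ P) (hNi : N.relIndex P = p) :
    N.Normal := by
  have hpf := Fact.mk hp
  have hsyl : ∀ (q : ℕ) (_ : Fact q.Prime) (Q : Sylow q A), (Q : Subgroup A).Normal :=
    (Group.isNilpotent_of_finite_tfae (G := A)).out 0 3 rfl rfl |>.mp ‹_›
  rw [← Subgroup.normalizer_eq_top_iff]
  apply aux_eq_top_of_sylow
  intro q hq Q
  have hqf := Fact.mk hq
  by_cases hqp : q = p
  · subst hqp
    have : Subsingleton (Sylow q A) := (Sylow.unique_of_normal P (hsyl q hqf P)).instSubsingleton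
    rw [Subsingleton.elim Q P]
    have h1 : (N.subgroupOf P).Normal := aux_index_normal hp P.2 _ hNi
    exact Subgroup.normal_subgroupOf_iff_le_normalizer hN |>.mp h1
  · intro x hx
    have hd : Disjoint (Q : Subgroup A) P := IsPGroup.disjoint_of_ne q p hqp _ _ Q.2 P.2
    have hcomm : ∀ y ∈ N, x * y = y * x := fun y hy =>
      Subgroup.commute_of_normal_of_disjoint _ _ (hsyl q hqf Q) (hsyl p hpf P) hd x y hx (hN hy)
    rw [Subgroup.mem_normalizer_iff]
    intro y
    constructor
    · intro hy
      rw [hcomm y hy, mul_inv_cancel_right]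
      exact hy
    · intro hy
      have h2 := hcomm _ hy
      have h3 : y = x * y * x⁻¹ := by
        have : x * (x * y * x⁻¹) * x⁻¹ = x * y * x⁻¹ := by rw [h2, mul_inv_cancel_right]
        have h4 := congrArg (fun z => x⁻¹ * z * x) this
        simpa [mul_assoc] using h4.symm
      rw [h3]
      exact hy

theorem aux_nilp {A : Type*} [Group A] [Finite A] [Group.IsNilpotent A] {p : ℕ}
    (hp : p.Prime) (P : Sylow p A) (N : Subgroup A) (hN : N ≤ P) (hNi : N.relIndex P = p) :
    ∃ M : Subgroup A, N ≤ M ∧ M.index = p := by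
  have hpf := Fact.mk hp
  have hNn := aux_nilp_normal hp P N hN hNi
  have hPn : (P : Subgroup A).Normal :=
    ((Group.isNilpotent_of_finite_tfae (G := A)).out 0 3 rfl rfl |>.mp ‹_›) p hpf P
  have hsurj := QuotientGroup.mk'_surjective N
  have hQn : ((P : Subgroup A).map (QuotientGroup.mk' N)).Normal := hPn.map _ hsurj
  have hcard : Nat.card ((P : Subgroup A).map (QuotientGroup.mk' N)) = p := by
    have h1 := Subgroup.relIndex_ker (P : Subgroup A) (QuotientGroup.mk' N)
    rw [QuotientGroup.ker_mk', hNi] at h1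
    exact h1.symm
  have hidx : ((P : Subgroup A).map (QuotientGroup.mk' N)).index = (P : Subgroup A).index :=
    Subgroup.index_map_eq _ hsurj (by rwa [QuotientGroup.ker_mk'])
  obtain ⟨K, hK⟩ := Subgroup.exists_right_complement'_of_coprime
    (N := (P : Subgroup A).map (QuotientGroup.mk' N)) (by
      rw [hcard, hidx]
      exact (Nat.Prime.coprime_iff_not_dvd hp).mpr P.not_dvd_index)
  refine ⟨K.comap (QuotientGroup.mk' N), ?_, ?_⟩
  · have := (QuotientGroup.mk' N).ker_le_comap K
    rwa [QuotientGroup.ker_mk'] at this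
  · rw [Subgroup.index_comap_of_surjective _ hsurj, hK.index_eq_card, hcard]

theorem aux_perm {G : Type*} [Group G] (S B : Subgroup G)
    (h : (S : Set G) * (B : Set G) = (B : Set G) * (S : Set G)) :
    ∃ T : Subgroup G, S ≤ T ∧ B ≤ T ∧ S.relIndex T = S.relIndex B := by
  let T : Subgroup G :=
    { carrier := (B : Set G) * (S : Set G)
      one_mem' := ⟨1, B.one_mem, 1, S.one_mem, mul_one 1⟩
      mul_mem' := by
        rintro _ _ ⟨b, hb, s, hs, rfl⟩ ⟨b', hb', s', hs', rfl⟩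
        obtain ⟨b2, hb2, s2, hs2, he⟩ : s * b' ∈ (B : Set G) * (S : Set G) := by
          rw [← h]
          exact ⟨s, hs, b', hb', rfl⟩
        refine ⟨b * b2, B.mul_mem hb hb2, s2 * s', S.mul_mem hs2 hs', ?_⟩
        simp only at he ⊢
        rw [mul_assoc b b2, ← mul_assoc b2, he]
        group
      inv_mem' := by
        rintro _ ⟨b, hb, s, hs, rfl⟩
        change (b * s)⁻¹ ∈ (B : Set G) * (S : Set G)
        rw [← h, mul_inv_rev]
        exact ⟨s⁻¹, S.inv_mem hs, b⁻¹, B.inv_mem hb, rfl⟩ }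
  have hS : S ≤ T := fun s hs => ⟨1, B.one_mem, s, hs, one_mul s⟩
  have hB : B ≤ T := fun b hb => ⟨b, hb, 1, S.one_mem, mul_one b⟩
  refine ⟨T, hS, hB, ?_⟩
  have hbij : Function.Bijective (Subgroup.quotientSubgroupOfEmbeddingOfLE S hB) := by
    refine ⟨(Subgroup.quotientSubgroupOfEmbeddingOfLE S hB).injective, ?_⟩
    intro z
    obtain ⟨⟨_, b, hb, s, hs, rfl⟩, rfl⟩ := QuotientGroup.mk_surjective z
    refine ⟨QuotientGroup.mk ⟨b, hb⟩, ?_⟩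
    rw [Subgroup.quotientSubgroupOfEmbeddingOfLE_apply_mk, QuotientGroup.eq,
      Subgroup.mem_subgroupOf]
    change b⁻¹ * (b * s) ∈ S
    rwa [inv_mul_cancel_left]
  exact (Nat.card_congr (Equiv.ofBijective _ hbij)).symm

theorem aux_propP {G : Type*} [Group G] [Finite G] {I : Type*} (σ : I → Set ℕ)
    (hσ : IsPrimePartition σ)
    (t : ℕ) (idx : Fin t → I) (H : Fin t → Subgroup G)
    (hinj : Function.Injective idx)
    (hcomplete : ∀ i : I, SigmaMem σ G i ↔ ∃ k, idx k = i)
    (hHall : ∀ k, IsHallSigmaIn (σ (idx k)) (H k) ⊤)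
    (hnilp : ∀ k, Group.IsNilpotent (H k))
    (hmax : ∀ k, ¬ IsCyclic (H k) → ∀ M : Subgroup (H k), IsCoatom M →
      ∃ S : Subgroup G, IsSylowizerIn (σ (idx k)) ⊤ (M.map (H k).subtype) S ∧
        ∀ l, CPermutable S (H l)) : PropP G := by
  intro p hp
  have hpf := Fact.mk hp
  obtain ⟨-, hprime, hcover, hdisj⟩ := hσ
  have hk : ∀ q : ℕ, q.Prime → q ∣ Nat.card G → ∃ k, q ∈ σ (idx k) := by
    intro q hq hqd
    obtain ⟨i, hi⟩ := hcover q hq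
    obtain ⟨k, rfl⟩ := (hcomplete i).mp ⟨q, hi, hqd⟩
    exact ⟨k, hi⟩
  have huniq : ∀ q k l, q ∈ σ (idx k) → q ∈ σ (idx l) → k = l := by
    intro q k l h1 h2
    by_contra hne
    exact Set.disjoint_left.mp (hdisj _ _ (fun h => hne (hinj h))) h1 h2
  have hidx : ∀ k q, q.Prime → q ∈ σ (idx k) → ¬ q ∣ (H k).index := by
    intro k q hq hqk
    have := (hHall k).2.2 q hq hqk
    rwa [Subgroup.relIndex_top_right] at this
  by_cases hpd : p ∣ Nat.card G
  swap
  · obtain ⟨P⟩ : Nonempty (Sylow p G) := inferInstance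
    refine ⟨P, Or.inl ?_⟩
    obtain h | h := P.2.card_eq_or_dvd
    · have : Subsingleton P := (Nat.card_eq_one_iff_unique.mp h).1
      infer_instance
    · exact absurd (h.trans (Subgroup.card_subgroup_dvd_card _)) hpd
  obtain ⟨k, hpk⟩ := hk p hp hpd
  obtain ⟨P⟩ : Nonempty (Sylow p (H k)) := inferInstance
  have hni : ¬ p ∣ ((P : Subgroup (H k)).map (H k).subtype).index := by
    rw [Subgroup.index_map_subtype]
    intro h
    rcases hp.dvd_mul.mp h with h | h
    · exact P.not_dvd_index h
    · exact hidx k p hp hpk h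
  refine ⟨(P.2.map (H k).subtype).toSylow hni, ?_⟩
  rw [IsPGroup.toSylow_coe]
  by_cases hcyc : IsCyclic (H k)
  · left
    exact isCyclic_of_surjective ((H k).subtype.subgroupMap (P : Subgroup (H k)))
      ((H k).subtype.subgroupMap_surjective P)
  right
  intro N hN hNi
  have hNH : N ≤ H k := hN.trans (Subgroup.map_subtype_le _)
  have hNm : (N.subgroupOf (H k)).map (H k).subtype = N := Subgroup.map_subgroupOf_eq_of_le hNH
  have hnk := hnilp k
  obtain ⟨M, hNM, hMi⟩ := aux_nilp hp P (N.subgroupOf (H k)) (by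
      rw [← Subgroup.map_subtype_le_map_subtype, hNm]
      exact hN) (by
      rw [← hNm, Subgroup.relIndex_map_map_of_injective _ _ (H k).subtype_injective] at hNi
      exact hNi)
  obtain ⟨S, ⟨-, hSH, hSmax⟩, hSc⟩ := hmax k hcyc M (aux_coatom M hp hMi)
  refine ⟨S, ?_, ?_⟩
  · rw [← hNm]
    exact (Subgroup.map_mono hNM).trans hSH.1
  have hMidx : (M.map (H k).subtype).index = p * (H k).index := by
    rw [Subgroup.index_map_subtype, hMi]
  have hSd : ∀ l, l ≠ k → S.index ∣ (H l).index := by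
    intro l hl
    obtain ⟨x, hx⟩ := hSc l
    obtain ⟨T, hST, hBT, hTi⟩ := aux_perm _ _ hx
    have hcardB : Nat.card (conjSubgroup x⁻¹ (H l)) = Nat.card (H l) :=
      Subgroup.card_map_of_injective (MulAut.conj x⁻¹).injective
    have hTS : T = S := by
      apply hSmax T le_top _ hST
      refine ⟨hSH.1.trans hST, hSH.2.1, ?_⟩
      intro q hq hqk hqd
      rw [← Subgroup.relIndex_mul_relIndex _ _ _ hSH.1 hST] at hqd
      rcases hq.dvd_mul.mp hqd with h | h
      · exact hSH.2.2 q hq hqk h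
      · rw [hTi] at h
        have h1 := h.trans (Subgroup.relIndex_dvd_card _ _)
        rw [hcardB] at h1
        exact hl (huniq q l k ((hHall l).2.1 q hq h1) hqk)
    rw [hTS] at hBT
    have h2 := Subgroup.index_dvd_of_le hBT
    have h3 : (conjSubgroup x⁻¹ (H l)).index = (H l).index :=
      Subgroup.index_map_equiv (H l) (MulAut.conj x⁻¹)
    rwa [h3] at h2
  have hcop : Nat.Coprime S.index (H k).index := by
    rw [Nat.coprime_iff_gcd_eq_one] 
    by_contra hne
    obtain ⟨q, hq, hqd⟩ := Nat.exists_prime_and_dvd hne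
    have h1 := hqd.trans (Nat.gcd_dvd_left _ _)
    have h2 := hqd.trans (Nat.gcd_dvd_right _ _)
    obtain ⟨l, hl⟩ := hk q hq (h1.trans S.index_dvd_card)
    by_cases hlk : l = k
    · subst hlk
      exact hidx l q hq hl h2
    · exact hidx l q hq hl (h1.trans (hSd l hlk))
  have hdvd : S.index ∣ p := by
    have h1 := Subgroup.index_dvd_of_le hSH.1
    rw [hMidx] at h1
    exact hcop.dvd_of_dvd_mul_right h1
  refine ((Nat.dvd_prime hp).mp hdvd).resolve_left fun h1 => ?_
  have hStop := Subgroup.index_eq_one.mp h1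
  apply hSH.2.2 p hp hpk
  rw [hStop, Subgroup.relIndex_top_right, hMidx]
  exact Dvd.intro _ rfl

/-- If `G` is a `σ`-full group of Sylow type with a complete Hall `σ`-set
`{H 1, …, H t}` of nilpotent subgroups, and for every `i` with `H i` non-cyclic every
maximal subgroup of `H i` has a `σᵢ`-sylowizer in `G` that is `c`-permutable with every
member of the Hall `σ`-set, then `G` is supersoluble. -/
theorem stmt_7 {G : Type*} [Group G] [Finite G] {I : Type*} (σ : I → Set ℕ)
    (hσ : IsPrimePartition σ) (hfull : SigmaFullSylowType σ G)
    (t : ℕ) (idx : Fin t → I) (H : Fin t → Subgroup G)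
    (hinj : Function.Injective idx)
    (hcomplete : ∀ i : I, SigmaMem σ G i ↔ ∃ k, idx k = i)
    (hHall : ∀ k, IsHallSigmaIn (σ (idx k)) (H k) ⊤)
    (hnilp : ∀ k, Group.IsNilpotent (H k))
    (hmax : ∀ k, ¬ IsCyclic (H k) → ∀ M : Subgroup (H k), IsCoatom M →
      ∃ S : Subgroup G, IsSylowizerIn (σ (idx k)) ⊤ (M.map (H k).subtype) S ∧
        ∀ l, CPermutable S (H l)) :
    IsSupersoluble G := by
  exact PropP.supersoluble _ (aux_propP σ hσ t idx H hinj hcomplete hHall hnilp hmax) rfl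
end
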